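/- Assume f : 𝒳ⁿ × ℝᵐ → ℝⁿ is Lipschitz on bounded sets with f(0,0) = 0. The following are equivalent: (1) the system ẋ(t) = f(x_t, u(t)) is ISS; (2) there exist a coercive LKF V, α of class 𝒦∞ and γ of class 𝒩 such that D⁺V(φ, f(φ,v)) ≤ −α(‖φ‖) + γ(|v|) for all φ ∈ 𝒳ⁿ and v ∈ ℝᵐ; (3) there exist an LKF V, α of class 𝒦∞ and γ of class 𝒩 such that D⁺V(φ, f(φ,v)) ≤ −α(V(φ)) + γ(|v|) for all φ, v; (4) there exist an LKF V, α of class 𝒫 and χ of class 𝒩 such that for all φ, v: V(φ) ≥ χ(|v|) implies D⁺V(φ, f(φ,v)) ≤ −α(|φ(0)|). -/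

import Mathlib

open Set Filter MeasureTheory Topology
open scoped NNReal

noncomputable section

/-- `ℝⁿ` with the Euclidean norm. -/
abbrev Vec (n : ℕ) : Type := EuclideanSpace ℝ (Fin n)

/-- The state space `𝒳ⁿ = C([-Δ,0], ℝⁿ)`, equipped with the sup norm. -/
abbrev Hist (Δ : ℝ≥0) (n : ℕ) : Type :=
  ContinuousMap (Icc (-(Δ : ℝ)) (0 : ℝ)) (Vec n)

theorem zero_mem_IccD (Δ : ℝ≥0) : (0 : ℝ) ∈ Icc (-(Δ : ℝ)) (0 : ℝ) :=
  ⟨neg_nonpos.mpr Δ.coe_nonneg, le_refl 0⟩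

/-- `φ(0)`: the current value of a history segment. -/
def ev0 {Δ : ℝ≥0} {n : ℕ} (φ : Hist Δ n) : Vec n :=
  φ ⟨0, zero_mem_IccD Δ⟩

/-! ### Comparison functions -/

/-- Class `𝒦`: continuous, strictly increasing, zero at zero (on `[0,∞)`). -/
def ClassK (α : ℝ → ℝ) : Prop :=
  ContinuousOn α (Ici 0) ∧ StrictMonoOn α (Ici 0) ∧ α 0 = 0

/-- Class `𝒦∞`: class `𝒦` and unbounded. -/
def ClassKinf (α : ℝ → ℝ) : Prop :=
  ClassK α ∧ Tendsto α atTop atTop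

/-- Class `𝒩`: continuous, nondecreasing, zero at zero (on `[0,∞)`). -/
def ClassN (α : ℝ → ℝ) : Prop :=
  ContinuousOn α (Ici 0) ∧ MonotoneOn α (Ici 0) ∧ α 0 = 0

/-- Class `𝒫`: continuous, zero at zero, positive on `(0,∞)`. -/
def ClassP (α : ℝ → ℝ) : Prop :=
  ContinuousOn α (Ici 0) ∧ α 0 = 0 ∧ ∀ s : ℝ, 0 < s → 0 < α s

/-- Class `𝒦ℒ`. -/
def ClassKL (β : ℝ → ℝ → ℝ) : Prop :=
  (∀ t : ℝ, 0 ≤ t → ClassK fun s => β s t) ∧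
    ∀ s : ℝ, 0 ≤ s →
      ContinuousOn (β s) (Ici 0) ∧ AntitoneOn (β s) (Ici 0) ∧
        Tendsto (β s) atTop (𝓝 0)

/-! ### Inputs -/

/-- Admissible input: Lebesgue measurable and locally essentially bounded. -/
def IsInput {m : ℕ} (u : ℝ → Vec m) : Prop :=
  Measurable u ∧ ∀ T : ℝ, 0 < T → ∃ C : ℝ, ∀ᵐ t ∂volume, t ∈ Icc (0 : ℝ) T → ‖u t‖ ≤ C

/-- Essential supremum of `‖u‖` over a set of times. -/
def essBnd {m : ℕ} (u : ℝ → Vec m) (s : Set ℝ) : ℝ :=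
  sInf {C : ℝ | 0 ≤ C ∧ ∀ᵐ τ ∂volume, τ ∈ s → ‖u τ‖ ≤ C}

/-! ### History segments along a trajectory -/

-- The history segment `x_t ∈ 𝒳ⁿ` of a trajectory `x : ℝ → ℝⁿ` (with junk value `0`
-- when `x` is not continuous on `[t-Δ, t]`).
open Classical in
def seg (Δ : ℝ≥0) {n : ℕ} (x : ℝ → Vec n) (t : ℝ) : Hist Δ n :=
  if hx : ContinuousOn x (Icc (t - (Δ : ℝ)) t) then
    { toFun := fun τ => x (t + τ.1)
      continuous_toFun := by
        have h1 : Continuous fun τ : Icc (-(Δ : ℝ)) (0 : ℝ) => t + τ.1 :=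
          continuous_const.add continuous_subtype_val
        have h2 : ∀ τ : Icc (-(Δ : ℝ)) (0 : ℝ), t + τ.1 ∈ Icc (t - (Δ : ℝ)) t := by
          rintro ⟨τ, hτ⟩
          rw [mem_Icc] at hτ ⊢
          constructor
          · linarith [hτ.1]
          · linarith [hτ.2]
        exact hx.comp_continuous h1 h2 }
  else 0

/-! ### Driver's derivative and Dini derivative -/

/-- The deformed history `φ_{h,w}` appearing in Driver's derivative: for `0 ≤ h < Δ`,
`φ_{h,w}(s) = φ(s+h)` for `s ∈ [-Δ,-h)` and `φ_{h,w}(s) = φ(0) + w(h+s)` for `s ∈ [-h,0]`. -/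
def shiftSeg {Δ : ℝ≥0} {n : ℕ} (φ : Hist Δ n) (w : Vec n) (h : ℝ) : Hist Δ n :=
  { toFun := fun s =>
      φ (projIcc (-(Δ : ℝ)) 0 (neg_nonpos.mpr Δ.coe_nonneg) (s.1 + h)) + max (h + s.1) 0 • w
    continuous_toFun := by
      refine Continuous.add ?_ ?_
      · exact φ.continuous.comp (continuous_projIcc.comp
          (continuous_subtype_val.add continuous_const))
      · exact ((continuous_const.add continuous_subtype_val).max continuous_const).smul
          continuous_const }

/-- Driver's derivative `D⁺V(φ,w)`, valued in the extended reals. -/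
def driverD {Δ : ℝ≥0} {n : ℕ} (V : Hist Δ n → ℝ) (φ : Hist Δ n) (w : Vec n) : EReal :=
  limsup (fun h : ℝ => (((V (shiftSeg φ w h) - V φ) / h : ℝ) : EReal)) (𝓝[>] (0 : ℝ))

/-- Upper right-hand Dini derivative of `ν : ℝ → ℝ`, valued in the extended reals. -/
def diniD (ν : ℝ → ℝ) (t : ℝ) : EReal :=
  limsup (fun h : ℝ => (((ν (t + h) - ν t) / h : ℝ) : EReal)) (𝓝[>] (0 : ℝ))

/-! ### Lipschitz conditions -/

/-- `f : 𝒳ⁿ × ℝᵐ → ℝⁿ` is Lipschitz on bounded sets. -/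
def LipOnBounded {Δ : ℝ≥0} {n m : ℕ} (f : Hist Δ n → Vec m → Vec n) : Prop :=
  ∀ r : ℝ, 0 < r → ∃ L : ℝ, 0 < L ∧
    ∀ (φ₁ φ₂ : Hist Δ n) (v₁ v₂ : Vec m),
      ‖φ₁‖ ≤ r → ‖φ₂‖ ≤ r → ‖v₁‖ ≤ r → ‖v₂‖ ≤ r →
        ‖f φ₁ v₁ - f φ₂ v₂‖ ≤ L * (‖φ₁ - φ₂‖ + ‖v₁ - v₂‖)

/-- An input-free vector field `f₀ : 𝒳ⁿ → ℝⁿ` Lipschitz on bounded sets. -/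
def LipOnBounded₀ {Δ : ℝ≥0} {n : ℕ} (f₀ : Hist Δ n → Vec n) : Prop :=
  ∀ r : ℝ, 0 < r → ∃ L : ℝ, 0 < L ∧
    ∀ φ₁ φ₂ : Hist Δ n, ‖φ₁‖ ≤ r → ‖φ₂‖ ≤ r → ‖f₀ φ₁ - f₀ φ₂‖ ≤ L * ‖φ₁ - φ₂‖

/-- A functional `V : 𝒳ⁿ → ℝ` Lipschitz on bounded sets. -/
def LipOnBoundedV {Δ : ℝ≥0} {n : ℕ} (V : Hist Δ n → ℝ) : Prop :=
  ∀ r : ℝ, 0 < r → ∃ L : ℝ, 0 < L ∧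
    ∀ φ₁ φ₂ : Hist Δ n, ‖φ₁‖ ≤ r → ‖φ₂‖ ≤ r → |V φ₁ - V φ₂| ≤ L * ‖φ₁ - φ₂‖

/-- A functional `V : 𝒳ⁿ → ℝ` locally Lipschitz. -/
def LocallyLipV {Δ : ℝ≥0} {n : ℕ} (V : Hist Δ n → ℝ) : Prop :=
  ∀ φ : Hist Δ n, ∃ δ : ℝ, 0 < δ ∧ ∃ L : ℝ, 0 < L ∧
    ∀ φ₁ φ₂ : Hist Δ n, ‖φ₁ - φ‖ ≤ δ → ‖φ₂ - φ‖ ≤ δ → |V φ₁ - V φ₂| ≤ L * ‖φ₁ - φ₂‖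

/-! ### Solutions -/

/-- `x` is a solution of `ẋ(t) = f(x_t, u(t))` with initial state `x₀` on `[0, tmax)`. -/
structure IsSolution (Δ : ℝ≥0) {n m : ℕ} (f : Hist Δ n → Vec m → Vec n)
    (u : ℝ → Vec m) (x₀ : Hist Δ n) (tmax : EReal) (x : ℝ → Vec n) : Prop where
  tmax_pos : 0 < tmax
  cont : ContinuousOn x {s : ℝ | -(Δ : ℝ) ≤ s ∧ (s : EReal) < tmax}
  init : ∀ τ : Icc (-(Δ : ℝ)) (0 : ℝ), x τ.1 = x₀ τ
  integrable : ∀ t : ℝ, 0 ≤ t → (t : EReal) < tmax →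
    IntervalIntegrable (fun s => f (seg Δ x s) (u s)) volume 0 t
  integral_eq : ∀ t : ℝ, 0 ≤ t → (t : EReal) < tmax →
    x t = x 0 + ∫ s in (0:ℝ)..t, f (seg Δ x s) (u s)

/-- Maximal solution: a solution admitting no proper extension. -/
def IsMaxSolution (Δ : ℝ≥0) {n m : ℕ} (f : Hist Δ n → Vec m → Vec n)
    (u : ℝ → Vec m) (x₀ : Hist Δ n) (tmax : EReal) (x : ℝ → Vec n) : Prop :=
  IsSolution Δ f u x₀ tmax x ∧
    ∀ (tmax' : EReal) (x' : ℝ → Vec n), IsSolution Δ f u x₀ tmax' x' →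
      (∀ t : ℝ, -(Δ : ℝ) ≤ t → (t : EReal) < tmax → x' t = x t) → tmax' ≤ tmax

/-- Solution of the input-free system `ẋ(t) = f₀(x_t)`. -/
def IsSolution₀ (Δ : ℝ≥0) {n : ℕ} (f₀ : Hist Δ n → Vec n) (x₀ : Hist Δ n)
    (tmax : EReal) (x : ℝ → Vec n) : Prop :=
  IsSolution Δ (fun φ (_ : Vec 0) => f₀ φ) (fun _ => 0) x₀ tmax x

/-- Maximal solution of the input-free system `ẋ(t) = f₀(x_t)`. -/
def IsMaxSolution₀ (Δ : ℝ≥0) {n : ℕ} (f₀ : Hist Δ n → Vec n) (x₀ : Hist Δ n)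
    (tmax : EReal) (x : ℝ → Vec n) : Prop :=
  IsMaxSolution Δ (fun φ (_ : Vec 0) => f₀ φ) (fun _ => 0) x₀ tmax x

/-! ### Stability properties (input-free systems) -/

/-- Global asymptotic stability (GAS). -/
def GAS (Δ : ℝ≥0) {n : ℕ} (f₀ : Hist Δ n → Vec n) : Prop :=
  ∃ β : ℝ → ℝ → ℝ, ClassKL β ∧
    ∀ (x₀ : Hist Δ n) (tmax : EReal) (x : ℝ → Vec n),
      IsMaxSolution₀ Δ f₀ x₀ tmax x →
        tmax = ⊤ ∧ ∀ t : ℝ, 0 ≤ t → ‖x t‖ ≤ β ‖x₀‖ t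

/-- Global exponential stability (GES). -/
def GES (Δ : ℝ≥0) {n : ℕ} (f₀ : Hist Δ n → Vec n) : Prop :=
  ∃ k : ℝ, 1 ≤ k ∧ ∃ lam : ℝ, 0 < lam ∧
    ∀ (x₀ : Hist Δ n) (tmax : EReal) (x : ℝ → Vec n),
      IsMaxSolution₀ Δ f₀ x₀ tmax x →
        tmax = ⊤ ∧ ∀ t : ℝ, 0 ≤ t → ‖x t‖ ≤ k * ‖x₀‖ * Real.exp (-lam * t)

/-- (Local) asymptotic stability (AS) of the origin. -/
def AS (Δ : ℝ≥0) {n : ℕ} (f₀ : Hist Δ n → Vec n) : Prop :=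
  ∃ r : ℝ, 0 < r ∧ ∃ β : ℝ → ℝ → ℝ, ClassKL β ∧
    ∀ (x₀ : Hist Δ n) (tmax : EReal) (x : ℝ → Vec n),
      IsMaxSolution₀ Δ f₀ x₀ tmax x → ‖x₀‖ ≤ r →
        tmax = ⊤ ∧ ∀ t : ℝ, 0 ≤ t → ‖x t‖ ≤ β ‖x₀‖ t

/-- (Local) exponential stability (ES) of the origin. -/
def ES (Δ : ℝ≥0) {n : ℕ} (f₀ : Hist Δ n → Vec n) : Prop :=
  ∃ r : ℝ, 0 < r ∧ ∃ k : ℝ, 1 ≤ k ∧ ∃ lam : ℝ, 0 < lam ∧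
    ∀ (x₀ : Hist Δ n) (tmax : EReal) (x : ℝ → Vec n),
      IsMaxSolution₀ Δ f₀ x₀ tmax x → ‖x₀‖ ≤ r →
        tmax = ⊤ ∧ ∀ t : ℝ, 0 ≤ t → ‖x t‖ ≤ k * ‖x₀‖ * Real.exp (-lam * t)

/-! ### Forward completeness -/

/-- Robust forward completeness (RFC) of `ẋ(t) = f(x_t,u(t))`. -/
def RFC (Δ : ℝ≥0) {n m : ℕ} (f : Hist Δ n → Vec m → Vec n) : Prop :=
  (∀ (x₀ : Hist Δ n) (u : ℝ → Vec m) (tmax : EReal) (x : ℝ → Vec n),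
      IsInput u → IsMaxSolution Δ f u x₀ tmax x → tmax = ⊤) ∧
    ∀ T : ℝ, 0 < T → ∀ r : ℝ, 0 < r → ∃ C : ℝ,
      ∀ (x₀ : Hist Δ n) (u : ℝ → Vec m) (tmax : EReal) (x : ℝ → Vec n),
        IsInput u → IsMaxSolution Δ f u x₀ tmax x →
          ‖x₀‖ ≤ r → essBnd u (Ici 0) ≤ r →
            ∀ t : ℝ, t ∈ Icc (0 : ℝ) T → ‖seg Δ x t‖ ≤ C

/-- Robust forward completeness of the input-free system `ẋ(t) = f₀(x_t)`. -/
def RFC₀ (Δ : ℝ≥0) {n : ℕ} (f₀ : Hist Δ n → Vec n) : Prop :=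
  RFC Δ (fun φ (_ : Vec 0) => f₀ φ)

/-! ### Input-to-state stability notions -/

/-- Input-to-state stability (ISS). -/
def ISS (Δ : ℝ≥0) {n m : ℕ} (f : Hist Δ n → Vec m → Vec n) : Prop :=
  ∃ β : ℝ → ℝ → ℝ, ∃ μ : ℝ → ℝ, ClassKL β ∧ ClassN μ ∧
    ∀ (x₀ : Hist Δ n) (u : ℝ → Vec m) (tmax : EReal) (x : ℝ → Vec n),
      IsInput u → IsMaxSolution Δ f u x₀ tmax x →
        tmax = ⊤ ∧ ∀ t : ℝ, 0 ≤ t → ‖x t‖ ≤ β ‖x₀‖ t + μ (essBnd u (Icc 0 t))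

/-- Local input-to-state stability (LISS). -/
def LISS (Δ : ℝ≥0) {n m : ℕ} (f : Hist Δ n → Vec m → Vec n) : Prop :=
  ∃ r : ℝ, 0 < r ∧ ∃ β : ℝ → ℝ → ℝ, ∃ μ : ℝ → ℝ, ClassKL β ∧ ClassN μ ∧
    ∀ (x₀ : Hist Δ n) (u : ℝ → Vec m) (tmax : EReal) (x : ℝ → Vec n),
      IsInput u → IsMaxSolution Δ f u x₀ tmax x →
        ‖x₀‖ ≤ r → essBnd u (Ici 0) ≤ r →
          tmax = ⊤ ∧ ∀ t : ℝ, 0 ≤ t → ‖x t‖ ≤ β ‖x₀‖ t + μ (essBnd u (Icc 0 t))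

/-- Integral input-to-state stability (iISS). -/
def iISS (Δ : ℝ≥0) {n m : ℕ} (f : Hist Δ n → Vec m → Vec n) : Prop :=
  ∃ β : ℝ → ℝ → ℝ, ∃ η μ : ℝ → ℝ, ClassKL β ∧ ClassN η ∧ ClassN μ ∧
    ∀ (x₀ : Hist Δ n) (u : ℝ → Vec m) (tmax : EReal) (x : ℝ → Vec n),
      IsInput u → IsMaxSolution Δ f u x₀ tmax x →
        tmax = ⊤ ∧ ∀ t : ℝ, 0 ≤ t →
          ‖x t‖ ≤ β ‖x₀‖ t + η (∫ s in (0:ℝ)..t, μ ‖u s‖)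

/-- The UBEBS estimate with offset `c`. -/
def UBEBSwith (Δ : ℝ≥0) {n m : ℕ} (f : Hist Δ n → Vec m → Vec n) (c : ℝ) : Prop :=
  ∃ α ξ ζ : ℝ → ℝ, ClassKinf α ∧ ClassKinf ξ ∧ ClassKinf ζ ∧
    ∀ (x₀ : Hist Δ n) (u : ℝ → Vec m) (tmax : EReal) (x : ℝ → Vec n),
      IsInput u → IsMaxSolution Δ f u x₀ tmax x →
        tmax = ⊤ ∧ ∀ t : ℝ, 0 ≤ t →
          α ‖x t‖ ≤ ξ ‖x₀‖ + (∫ s in (0:ℝ)..t, ζ ‖u s‖) + c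

/-! ### Lyapunov–Krasovskii functionals -/

/-- Lyapunov–Krasovskii functional candidate (LKF). -/
def IsLKF {Δ : ℝ≥0} {n : ℕ} (V : Hist Δ n → ℝ) : Prop :=
  (∀ φ, 0 ≤ V φ) ∧ LipOnBoundedV V ∧
    ∃ α₁ α₂ : ℝ → ℝ, ClassKinf α₁ ∧ ClassKinf α₂ ∧
      ∀ φ : Hist Δ n, α₁ ‖ev0 φ‖ ≤ V φ ∧ V φ ≤ α₂ ‖φ‖

/-- Coercive Lyapunov–Krasovskii functional candidate. -/
def IsCoerciveLKF {Δ : ℝ≥0} {n : ℕ} (V : Hist Δ n → ℝ) : Prop :=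
  (∀ φ, 0 ≤ V φ) ∧ LipOnBoundedV V ∧
    ∃ α₁ α₂ : ℝ → ℝ, ClassKinf α₁ ∧ ClassKinf α₂ ∧
      ∀ φ : Hist Δ n, α₁ ‖φ‖ ≤ V φ ∧ V φ ≤ α₂ ‖φ‖

end

section Segments
variable {Δ : ℝ≥0} {n m : ℕ}

theorem seg_apply {x : ℝ → Vec n} {t : ℝ} (hx : ContinuousOn x (Icc (t - Δ) t))
    (τ : Icc (-(Δ : ℝ)) (0 : ℝ)) : seg Δ x t τ = x (t + τ.1) := by
  simp [seg, hx]

theorem seg_congr {x y : ℝ → Vec n} {t : ℝ} (h : EqOn x y (Icc (t - Δ) t)) :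
    seg Δ x t = seg Δ y t := by
  by_cases hx : ContinuousOn x (Icc (t - Δ) t)
  · have hy : ContinuousOn y (Icc (t - Δ) t) := hx.congr h.symm
    ext1 τ
    rw [seg_apply hx, seg_apply hy]
    exact h ⟨by linarith [τ.2.1], by linarith [τ.2.2]⟩
  · have hy : ¬ ContinuousOn y (Icc (t - Δ) t) := fun hy => hx (hy.congr h)
    simp [seg, hx, hy]

theorem ev0_seg {x : ℝ → Vec n} {t : ℝ} (hx : ContinuousOn x (Icc (t - Δ) t)) :
    ev0 (seg Δ x t) = x t := by
  rw [ev0, seg_apply hx]; simp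

theorem norm_ev0_le (φ : Hist Δ n) : ‖ev0 φ‖ ≤ ‖φ‖ := φ.norm_coe_le_norm _

theorem norm_seg_le {x : ℝ → Vec n} {t C : ℝ} (hC : 0 ≤ C)
    (h : ∀ s ∈ Icc (t - Δ) t, ‖x s‖ ≤ C) : ‖seg Δ x t‖ ≤ C := by
  by_cases hx : ContinuousOn x (Icc (t - Δ) t)
  · rw [ContinuousMap.norm_le _ hC]
    intro τ
    rw [seg_apply hx]
    exact h _ ⟨by linarith [τ.2.1], by linarith [τ.2.2]⟩
  · simpa [seg, hx] using hC

theorem norm_le_norm_seg {x : ℝ → Vec n} {t s : ℝ} (hx : ContinuousOn x (Icc (t - Δ) t))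
    (hs : s ∈ Icc (t - Δ) t) : ‖x s‖ ≤ ‖seg Δ x t‖ := by
  have := (seg Δ x t).norm_coe_le_norm ⟨s - t, by linarith [hs.1], by linarith [hs.2]⟩
  rwa [seg_apply hx, add_sub_cancel] at this

theorem norm_seg_sub_le {x y : ℝ → Vec n} {t t' C : ℝ} (hC : 0 ≤ C)
    (hx : ContinuousOn x (Icc (t - Δ) t)) (hy : ContinuousOn y (Icc (t' - Δ) t'))
    (h : ∀ τ ∈ Icc (-(Δ : ℝ)) 0, ‖x (t + τ) - y (t' + τ)‖ ≤ C) :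
    ‖seg Δ x t - seg Δ y t'‖ ≤ C := by
  rw [ContinuousMap.norm_le _ hC]
  intro τ
  rw [ContinuousMap.sub_apply, seg_apply hx, seg_apply hy]
  exact h _ τ.2

theorem norm_sub_le_norm_seg_sub {x y : ℝ → Vec n} {t s : ℝ}
    (hx : ContinuousOn x (Icc (t - Δ) t)) (hy : ContinuousOn y (Icc (t - Δ) t))
    (hs : s ∈ Icc (t - Δ) t) : ‖x s - y s‖ ≤ ‖seg Δ x t - seg Δ y t‖ := by
  have := (seg Δ x t - seg Δ y t).norm_coe_le_norm ⟨s - t, by linarith [hs.1], by linarith [hs.2]⟩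
  rwa [ContinuousMap.sub_apply, seg_apply hx, seg_apply hy, add_sub_cancel] at this

theorem continuous_seg {x : ℝ → Vec n} (hx : Continuous x) : Continuous (seg Δ x) := by
  have h : Continuous fun t : ℝ =>
      (⟨fun τ : Icc (-(Δ : ℝ)) (0 : ℝ) => x (t + τ.1), by fun_prop⟩ : Hist Δ n) := by
    refine ContinuousMap.continuous_of_continuous_uncurry _ ?_
    change Continuous fun p : ℝ × Icc (-(Δ : ℝ)) (0 : ℝ) => x (p.1 + p.2.1)
    fun_prop
  convert h using 2 with t
  ext1 τ
  rw [seg_apply hx.continuousOn]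
  rfl

/-- A trajectory frozen outside `[-Δ, T]`. -/
theorem exists_continuous_extension {x : ℝ → Vec n} {a T : ℝ} (haT : a ≤ T)
    (hx : ContinuousOn x (Icc a T)) :
    ∃ y : ℝ → Vec n, Continuous y ∧ EqOn y x (Icc a T) :=
  ⟨IccExtend haT ((Icc a T).domRestrict x), hx.domRestrict.Icc_extend', fun s hs => by
    rw [IccExtend_of_mem _ _ hs]; rfl⟩

theorem continuousOn_seg {x : ℝ → Vec n} {a T : ℝ}
    (hx : ContinuousOn x (Icc (a - Δ) T)) : ContinuousOn (seg Δ x) (Icc a T) := by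
  rcases le_or_gt a T with haT | haT
  · obtain ⟨y, hy, hyx⟩ := exists_continuous_extension
      (by linarith [Δ.coe_nonneg] : a - (Δ : ℝ) ≤ T) hx
    refine (continuous_seg (Δ := Δ) hy).continuousOn.congr fun t ht => ?_
    exact seg_congr fun s hs => (hyx ⟨by linarith [hs.1, ht.1], by linarith [hs.2, ht.2]⟩).symm
  · simp [Icc_eq_empty haT.not_ge]

theorem seg_zero_of_init {x : ℝ → Vec n} {φ : Hist Δ n}
    (h : ∀ τ : Icc (-(Δ : ℝ)) (0 : ℝ), x τ.1 = φ τ) : seg Δ x 0 = φ := by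
  have hx : ContinuousOn x (Icc (0 - (Δ : ℝ)) 0) := by
    rw [zero_sub, continuousOn_iff_continuous_domRestrict]
    convert φ.continuous using 1
    ext1 τ
    exact h τ
  ext1 τ
  rw [seg_apply hx, zero_add, h]

end Segments

/-- Integral form of Gronwall's inequality for continuous functions. -/
theorem le_mul_exp_of_le_add_integral {w : ℝ → ℝ} {a L T : ℝ} (hL : 0 ≤ L)
    (hw : ContinuousOn w (Icc 0 T))
    (h : ∀ t ∈ Icc (0 : ℝ) T, w t ≤ a + L * ∫ s in (0 : ℝ)..t, w s) :
    ∀ t ∈ Icc (0 : ℝ) T, w t ≤ a * Real.exp (L * t) := by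
  intro t ht
  have hT : 0 ≤ T := ht.1.trans ht.2
  have hint : ∀ s ∈ Icc (0 : ℝ) T, IntervalIntegrable w volume 0 s := fun s hs =>
    (hw.mono (by rw [uIcc_of_le hs.1]; exact Icc_subset_Icc_right hs.2)).intervalIntegrable
  have hcont : ContinuousOn (fun t => a + L * ∫ s in (0 : ℝ)..t, w s) (Icc 0 T) := by
    have := intervalIntegral.continuousOn_primitive_interval' (hint T ⟨hT, le_rfl⟩)
      (left_mem_uIcc)
    rw [uIcc_of_le hT] at this
    fun_prop
  have hderiv : ∀ t ∈ Ico (0 : ℝ) T,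
      HasDerivWithinAt (fun t => a + L * ∫ s in (0 : ℝ)..t, w s) (L * w t) (Ici t) t := by
    intro t ht
    have hIcc : Icc t T ∈ 𝓝[≥] t := Icc_mem_nhdsGE ht.2
    have hc : ContinuousWithinAt w (Ioi t) t :=
      ((hw t ⟨ht.1, ht.2.le⟩).mono (Icc_subset_Icc_left ht.1)).mono_of_mem_nhdsWithin
        (mem_of_superset (Icc_mem_nhdsGT ht.2) subset_rfl)
    have := intervalIntegral.integral_hasDerivWithinAt_right (s := Ici t) (t := Ioi t)
      (hint t ⟨ht.1, ht.2.le⟩) ⟨Icc t T, Icc_mem_nhdsGT ht.2,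
      (hw.mono (Icc_subset_Icc_left ht.1)).aestronglyMeasurable measurableSet_Icc⟩ hc
    exact (this.const_mul L).const_add a
  have := le_gronwallBound_of_liminf_deriv_right_le (f := fun t => a + L * ∫ s in (0 : ℝ)..t, w s)
    (f' := fun t => L * w t) (δ := a) (K := L) (ε := 0) hcont
    (fun t ht r hr => (hderiv t ht).liminf_right_slope_le hr) (by simp)
    (fun t ht => by
      rw [add_zero]
      exact mul_le_mul_of_nonneg_left (h t ⟨ht.1, ht.2.le⟩) hL) t ht
  rw [gronwallBound_ε0, sub_zero] at this
  exact (h t ht).trans this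

/-- Continuous dependence on the initial segment for trajectories given as primitives. -/
theorem norm_seg_sub_le_exp {Δ : ℝ≥0} {n : ℕ} {x y F G : ℝ → Vec n} {L T : ℝ} (hL : 0 ≤ L)
    (hx : ContinuousOn x (Icc (-(Δ : ℝ)) T)) (hy : ContinuousOn y (Icc (-(Δ : ℝ)) T))
    (hF : IntervalIntegrable F volume 0 T) (hG : IntervalIntegrable G volume 0 T)
    (hxF : ∀ t ∈ Icc (0 : ℝ) T, x t = x 0 + ∫ s in (0 : ℝ)..t, F s)
    (hyG : ∀ t ∈ Icc (0 : ℝ) T, y t = y 0 + ∫ s in (0 : ℝ)..t, G s)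
    (hFG : ∀ᵐ s, s ∈ Icc (0 : ℝ) T → ‖F s - G s‖ ≤ L * ‖seg Δ x s - seg Δ y s‖) :
    ∀ t ∈ Icc (0 : ℝ) T,
      ‖seg Δ x t - seg Δ y t‖ ≤ ‖seg Δ x 0 - seg Δ y 0‖ * Real.exp (L * t) := by
  have hΔ := Δ.coe_nonneg
  have hsx : ContinuousOn (seg Δ x) (Icc 0 T) := continuousOn_seg (by rwa [zero_sub])
  have hsy : ContinuousOn (seg Δ y) (Icc 0 T) := continuousOn_seg (by rwa [zero_sub])
  have hw : ContinuousOn (fun s => ‖seg Δ x s - seg Δ y s‖) (Icc 0 T) := (hsx.sub hsy).norm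
  have hwin : ∀ t ∈ Icc (0 : ℝ) T, Icc (t - Δ) t ⊆ Icc (-(Δ : ℝ)) T := fun t ht =>
    Icc_subset_Icc (by linarith [ht.1]) ht.2
  have hint : ∀ s ∈ Icc (0 : ℝ) T, IntervalIntegrable (fun s => ‖seg Δ x s - seg Δ y s‖)
      volume 0 s := fun s hs =>
    (hw.mono (by rw [uIcc_of_le hs.1]; exact Icc_subset_Icc_right hs.2)).intervalIntegrable
  refine le_mul_exp_of_le_add_integral hL hw fun t ht => ?_
  have hmono : ∀ s ∈ Icc (0 : ℝ) t, ∫ r in (0 : ℝ)..s, ‖seg Δ x r - seg Δ y r‖ ≤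
      ∫ r in (0 : ℝ)..t, ‖seg Δ x r - seg Δ y r‖ := fun s hs =>
    intervalIntegral.integral_mono_interval le_rfl hs.1 hs.2
      (Eventually.of_forall fun _ => norm_nonneg _) (hint t ht)
  have hnn : ∀ s ∈ Icc (0 : ℝ) t, 0 ≤ ∫ r in (0 : ℝ)..s, ‖seg Δ x r - seg Δ y r‖ := fun s hs =>
    intervalIntegral.integral_nonneg hs.1 fun _ _ => norm_nonneg _
  have h0 : (0 : ℝ) ∈ Icc (0 : ℝ) T := ⟨le_rfl, ht.1.trans ht.2⟩
  refine norm_seg_sub_le (by have := hnn t ⟨ht.1, le_rfl⟩; positivity)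
    (hx.mono (hwin t ht)) (hy.mono (hwin t ht)) fun τ hτ => ?_
  rcases le_total 0 (t + τ) with hs | hs
  · have hs' : t + τ ∈ Icc (0 : ℝ) t := ⟨hs, by linarith [hτ.2]⟩
    have hsT : t + τ ∈ Icc (0 : ℝ) T := ⟨hs, by linarith [hτ.2, ht.2]⟩
    have hsub : uIcc 0 (t + τ) ⊆ uIcc 0 T := by
      rw [uIcc_of_le hs, uIcc_of_le h0.2]; exact Icc_subset_Icc_right hsT.2
    have hF' := hF.mono_set hsub
    have hG' := hG.mono_set hsub
    have e : x (t + τ) - y (t + τ) = (x 0 - y 0) + ∫ s in (0 : ℝ)..(t + τ), (F s - G s) := by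
      rw [hxF _ hsT, hyG _ hsT, intervalIntegral.integral_sub hF' hG']
      abel
    rw [e]
    refine (norm_add_le _ _).trans (add_le_add (norm_sub_le_norm_seg_sub (hx.mono (hwin 0 h0))
      (hy.mono (hwin 0 h0)) ⟨by linarith, le_rfl⟩) ?_)
    refine (intervalIntegral.norm_integral_le_of_norm_le hs ?_
      ((hint _ hsT).const_mul L)).trans ?_
    · filter_upwards [hFG] with s h1 h2
      exact h1 ⟨h2.1.le, h2.2.trans hsT.2⟩
    · rw [intervalIntegral.integral_const_mul]
      exact mul_le_mul_of_nonneg_left (hmono _ hs') hL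
  · refine (norm_sub_le_norm_seg_sub (hx.mono (hwin 0 h0)) (hy.mono (hwin 0 h0))
      ⟨by linarith [hτ.1, ht.1], hs⟩).trans ?_
    have := hnn t ⟨ht.1, le_rfl⟩
    have := mul_nonneg hL this
    linarith

/-- Radial retraction onto the closed ball of radius `R`. -/
noncomputable def radialRetract {E : Type*} [NormedAddCommGroup E] [NormedSpace ℝ E] (R : ℝ)
    (φ : E) : E :=
  (R / max R ‖φ‖) • φ

section RadialRetract
variable {E : Type*} [NormedAddCommGroup E] [NormedSpace ℝ E] {R : ℝ}

theorem radialRetract_of_norm_le (hR : 0 < R) {φ : E} (h : ‖φ‖ ≤ R) : radialRetract R φ = φ := by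
  rw [radialRetract, max_eq_left h, div_self hR.ne', one_smul]

theorem norm_radialRetract_le (hR : 0 < R) (φ : E) : ‖radialRetract R φ‖ ≤ R := by
  have hm : 0 < max R ‖φ‖ := lt_max_of_lt_left hR
  rw [radialRetract, norm_smul, Real.norm_of_nonneg (by positivity), div_mul_eq_mul_div,
    div_le_iff₀ hm]
  exact mul_le_mul_of_nonneg_left (le_max_right _ _) hR.le

theorem norm_radialRetract_sub_le (hR : 0 < R) (φ ψ : E) :
    ‖radialRetract R φ - radialRetract R ψ‖ ≤ 2 * ‖φ - ψ‖ := by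
  have ha : 0 < max R ‖φ‖ := lt_max_of_lt_left hR
  have hb : 0 < max R ‖ψ‖ := lt_max_of_lt_left hR
  have e : radialRetract R φ - radialRetract R ψ =
      (R / max R ‖φ‖) • (φ - ψ) + (R / max R ‖φ‖ - R / max R ‖ψ‖) • ψ := by
    simp only [radialRetract, smul_sub, sub_smul]; abel
  have h1 : R / max R ‖φ‖ ≤ 1 := (div_le_one ha).2 (le_max_left _ _)
  have h0 : 0 ≤ R / max R ‖φ‖ := by positivity
  have h2 : |R / max R ‖φ‖ - R / max R ‖ψ‖| * ‖ψ‖ ≤ ‖φ - ψ‖ := by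
    have e2 : R / max R ‖φ‖ - R / max R ‖ψ‖ =
        R / max R ‖φ‖ * ((max R ‖ψ‖ - max R ‖φ‖) / max R ‖ψ‖) := by
      field_simp
    have h3 : |max R ‖ψ‖ - max R ‖φ‖| ≤ ‖φ - ψ‖ := by
      rw [max_comm R, max_comm R]
      refine (abs_max_sub_max_le_abs _ _ _).trans ?_
      rw [abs_sub_comm]
      exact abs_norm_sub_norm_le _ _
    rw [e2, abs_mul, abs_of_nonneg h0, abs_div, abs_of_pos hb, mul_assoc,
      div_mul_eq_mul_div _ (max R ‖ψ‖)]
    calc R / max R ‖φ‖ * (|max R ‖ψ‖ - max R ‖φ‖| * ‖ψ‖ / max R ‖ψ‖)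
        ≤ 1 * (|max R ‖ψ‖ - max R ‖φ‖| * max R ‖ψ‖ / max R ‖ψ‖) := by
          gcongr
          exact le_max_right _ _
      _ ≤ ‖φ - ψ‖ := by rwa [one_mul, mul_div_cancel_right₀ _ hb.ne']
  rw [e]
  refine (norm_add_le _ _).trans ?_
  rw [norm_smul, norm_smul, Real.norm_of_nonneg h0, Real.norm_eq_abs]
  have := mul_le_mul_of_nonneg_right h1 (norm_nonneg (φ - ψ))
  linarith

end RadialRetract

section GlobalExistence
open scoped BoundedContinuousFunction
variable {Δ : ℝ≥0} {n m : ℕ}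

theorem measurable_seg_comp {g : Hist Δ n → Vec m → Vec n}
    (hg : Continuous fun p : Hist Δ n × Vec m => g p.1 p.2) {u : ℝ → Vec m} (hu : Measurable u)
    {x : ℝ → Vec n} (hx : Continuous x) :
    StronglyMeasurable fun s => g (seg Δ x s) (u s) :=
  hg.comp_stronglyMeasurable ((continuous_seg hx).stronglyMeasurable.prodMk hu.stronglyMeasurable)

/-- Global existence for a bounded, globally Lipschitz right-hand side: Banach's fixed point theorem
in an exponentially weighted space. -/
theorem exists_global_solution {g : Hist Δ n → Vec m → Vec n}
    (hg : Continuous fun p : Hist Δ n × Vec m => g p.1 p.2) {L K : ℝ} (hL : 0 ≤ L)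
    (hlip : ∀ φ ψ v, ‖g φ v - g ψ v‖ ≤ L * ‖φ - ψ‖) (hK : ∀ φ v, ‖g φ v‖ ≤ K)
    {u : ℝ → Vec m} (hu : Measurable u) (φ : Hist Δ n) :
    ∃ x : ℝ → Vec n, Continuous x ∧ (∀ τ : Icc (-(Δ : ℝ)) (0 : ℝ), x τ.1 = φ τ) ∧
      (∀ t, IntervalIntegrable (fun s => g (seg Δ x s) (u s)) volume 0 t) ∧
      ∀ t, 0 ≤ t → x t = x 0 + ∫ s in (0 : ℝ)..t, g (seg Δ x s) (u s) := by
  have hK0 : 0 ≤ K := (norm_nonneg _).trans (hK φ 0)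
  set lam : ℝ := 2 * (L + 1) with hlam
  have hlam0 : 0 < lam := by positivity
  have hΔ : -(Δ : ℝ) ≤ 0 := neg_nonpos.2 Δ.coe_nonneg
  let X : (ℝ →ᵇ Vec n) → ℝ → Vec n := fun y t =>
    φ (projIcc (-(Δ : ℝ)) 0 hΔ t) + Real.exp (lam * max t 0) • y t
  have hX : ∀ y, Continuous (X y) := fun y => by
    have h1 : Continuous fun t => φ (projIcc (-(Δ : ℝ)) 0 hΔ t) :=
      φ.continuous.comp continuous_projIcc
    have h2 := y.continuous
    fun_prop
  let G : (ℝ →ᵇ Vec n) → ℝ → Vec n := fun y s => g (seg Δ (X y) s) (u s)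
  have hGm : ∀ y, StronglyMeasurable (G y) := fun y => measurable_seg_comp hg hu (hX y)
  have hGi : ∀ y a b, IntervalIntegrable (G y) volume a b := fun y a b =>
    (intervalIntegrable_const (c := K)).mono_fun (hGm y).aestronglyMeasurable
      (Eventually.of_forall fun s => by
        rw [Real.norm_of_nonneg hK0]; exact hK _ _)
  let I : (ℝ →ᵇ Vec n) → ℝ → Vec n := fun y t => ∫ s in (0 : ℝ)..(max t 0), G y s
  have hI : ∀ y, Continuous (I y) := fun y =>
    (intervalIntegral.continuous_primitive (fun a b => hGi y a b) 0).comp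
      (continuous_id.max continuous_const)
  let Φ : (ℝ →ᵇ Vec n) → (ℝ →ᵇ Vec n) := fun y =>
    BoundedContinuousFunction.ofNormedAddCommGroup
      (fun t => Real.exp (-(lam * max t 0)) • I y t)
      (by have := hI y; fun_prop) (K / lam) (by
        intro t
        have ht : 0 ≤ max t 0 := le_max_right _ _
        have h1 : ‖I y t‖ ≤ K * |max t 0 - 0| :=
          intervalIntegral.norm_integral_le_of_norm_le_const fun s _ => hK _ _
        rw [sub_zero, abs_of_nonneg ht] at h1
        have h2 : lam * max t 0 ≤ Real.exp (lam * max t 0) := by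
          linarith [Real.add_one_le_exp (lam * max t 0)]
        rw [norm_smul, Real.norm_of_nonneg (Real.exp_pos _).le, Real.exp_neg, inv_mul_le_iff₀
          (Real.exp_pos _)]
        calc ‖I y t‖ ≤ K * max t 0 := h1
          _ = (lam * max t 0) * (K / lam) := by field_simp
          _ ≤ _ := mul_le_mul_of_nonneg_right h2 (by positivity))
  have hΦ : ∀ y t, Φ y t = Real.exp (-(lam * max t 0)) • I y t := fun y t => rfl
  have hcontr : ContractingWith (1 / 2) Φ := by
    refine ⟨by norm_num, LipschitzWith.of_dist_le_mul fun y z => ?_⟩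
    rw [BoundedContinuousFunction.dist_le (by positivity)]
    intro t
    have ht : 0 ≤ max t 0 := le_max_right _ _
    have hd : 0 ≤ dist y z := dist_nonneg
    rw [dist_eq_norm, hΦ, hΦ, ← smul_sub, norm_smul, Real.norm_of_nonneg (Real.exp_pos _).le,
      Real.exp_neg, inv_mul_le_iff₀ (Real.exp_pos _)]
    have e : I y t - I z t = ∫ s in (0 : ℝ)..(max t 0), (G y s - G z s) :=
      (intervalIntegral.integral_sub (hGi _ _ _) (hGi _ _ _)).symm
    have hb : ∀ s, 0 ≤ s → ‖G y s - G z s‖ ≤ L * (Real.exp (lam * s) * dist y z) := by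
      intro s hs
      refine (hlip _ _ _).trans (mul_le_mul_of_nonneg_left ?_ hL)
      refine norm_seg_sub_le (by positivity) (hX y).continuousOn (hX z).continuousOn ?_
      intro τ hτ
      have e3 : X y (s + τ) - X z (s + τ) =
          Real.exp (lam * max (s + τ) 0) • (y (s + τ) - z (s + τ)) := by
        simp only [X, smul_sub]; abel
      rw [e3, norm_smul, Real.norm_of_nonneg (Real.exp_pos _).le]
      have : max (s + τ) 0 ≤ s := max_le (by linarith [hτ.2]) hs
      gcongr
      rw [← dist_eq_norm]
      exact BoundedContinuousFunction.dist_coe_le_dist _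
    have hint : ∫ s in (0 : ℝ)..(max t 0), L * (Real.exp (lam * s) * dist y z) =
        L * dist y z * ((Real.exp (lam * max t 0) - 1) / lam) := by
      have : ∀ s : ℝ, L * (Real.exp (lam * s) * dist y z) =
          L * dist y z * Real.exp (lam * s) := fun s => by ring
      simp_rw [this]
      rw [intervalIntegral.integral_const_mul,
        intervalIntegral.integral_comp_mul_left (f := Real.exp) hlam0.ne', integral_exp]
      simp [div_eq_inv_mul]
    rw [e]
    refine (intervalIntegral.norm_integral_le_of_norm_le ht (Eventually.of_forall fun s hs =>
      hb s hs.1.le) (by apply Continuous.intervalIntegrable; fun_prop)).trans ?_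
    rw [hint]
    have h4 : L / lam ≤ 1 / 2 := by
      rw [div_le_div_iff₀ hlam0 two_pos]; rw [hlam]; linarith
    calc L * dist y z * ((Real.exp (lam * max t 0) - 1) / lam)
        = (L / lam) * ((Real.exp (lam * max t 0) - 1) * dist y z) := by ring
      _ ≤ (1 / 2) * (Real.exp (lam * max t 0) * dist y z) := by
          have h5 : 0 ≤ Real.exp (lam * max t 0) - 1 := by
            linarith [Real.one_le_exp (mul_nonneg hlam0.le ht)]
          have h6 : Real.exp (lam * max t 0) - 1 ≤ Real.exp (lam * max t 0) := by linarith
          gcongr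
      _ = _ := by push_cast; ring
  obtain ⟨y, hy⟩ : ∃ y, Φ y = y := ⟨_, hcontr.fixedPoint_isFixedPt⟩
  have hXI : ∀ t, X y t = φ (projIcc (-(Δ : ℝ)) 0 hΔ t) + I y t := by
    intro t
    have : y t = Real.exp (-(lam * max t 0)) • I y t := by rw [← hΦ, hy]
    simp only [X]
    rw [this, smul_smul, ← Real.exp_add, add_neg_cancel, Real.exp_zero, one_smul]
  refine ⟨X y, hX y, fun τ => ?_, fun t => hGi y 0 t, fun t ht => ?_⟩
  · have : I y τ.1 = 0 := by simp [I, max_eq_right τ.2.2]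
    rw [hXI, this, add_zero, projIcc_val]
  · have h0 : I y 0 = 0 := by simp [I]
    rw [hXI, hXI, h0, add_zero, projIcc_of_right_le _ ht, projIcc_right]
    simp only [I, max_eq_left ht, G]

end GlobalExistence

section Solutions
variable {Δ : ℝ≥0} {n m k : ℕ} {f : Hist Δ n → Vec m → Vec n} {f' : Hist Δ n → Vec k → Vec n}
  {u : ℝ → Vec m} {u' : ℝ → Vec k} {φ ψ : Hist Δ n} {tm tm' : EReal} {x y : ℝ → Vec n} {T : ℝ}

theorem LipOnBounded.continuous (hf : LipOnBounded f) :
    Continuous fun p : Hist Δ n × Vec m => f p.1 p.2 := by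
  rw [continuous_iff_continuousAt]
  rintro ⟨φ, v⟩
  obtain ⟨L, hL, h⟩ := hf (‖φ‖ + ‖v‖ + 1) (by positivity)
  rw [ContinuousAt, tendsto_iff_norm_sub_tendsto_zero]
  have hlim : Tendsto (fun p : Hist Δ n × Vec m => L * (‖p.1 - φ‖ + ‖p.2 - v‖)) (𝓝 (φ, v))
      (𝓝 0) := by
    have : Continuous fun p : Hist Δ n × Vec m => L * (‖p.1 - φ‖ + ‖p.2 - v‖) := by fun_prop
    simpa using this.tendsto (φ, v)
  have e1 : ∀ᶠ p : Hist Δ n × Vec m in 𝓝 (φ, v), ‖p.1‖ < ‖φ‖ + 1 :=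
    (continuous_fst.norm.tendsto (φ, v)).eventually_lt_const (by simp)
  have e2 : ∀ᶠ p : Hist Δ n × Vec m in 𝓝 (φ, v), ‖p.2‖ < ‖v‖ + 1 :=
    (continuous_snd.norm.tendsto (φ, v)).eventually_lt_const (by simp)
  refine squeeze_zero' (Eventually.of_forall fun _ => norm_nonneg _) ?_ hlim
  filter_upwards [e1, e2] with p h1 h2
  have := norm_nonneg φ
  have := norm_nonneg v
  exact h _ _ _ _ (by linarith) (by linarith) (by linarith) (by linarith)

theorem LipOnBounded.exists_bound (hf : LipOnBounded f) (r : ℝ) :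
    ∃ K : ℝ, 0 < K ∧ ∀ φ v, ‖φ‖ ≤ r → ‖v‖ ≤ r → ‖f φ v‖ ≤ K := by
  obtain ⟨L, hL, h⟩ := hf (|r| + 1) (by positivity)
  refine ⟨‖f 0 0‖ + L * ((|r| + 1) + (|r| + 1)), by positivity, fun φ v h1 h2 => ?_⟩
  have hr := le_abs_self r
  have := h φ 0 v 0 (by linarith) (by simp; positivity) (by linarith) (by simp; positivity)
  rw [sub_zero, sub_zero] at this
  have h3 : ‖f φ v‖ ≤ ‖f 0 0‖ + ‖f φ v - f 0 0‖ := norm_le_insert' _ _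
  refine h3.trans (add_le_add_right (this.trans ?_) _)
  exact mul_le_mul_of_nonneg_left (by linarith) hL.le

/-- The right-hand side precomposed with radial retractions of state and input. -/
noncomputable def truncRhs (f : Hist Δ n → Vec m → Vec n) (R : ℝ) :
    Hist Δ n → Vec m → Vec n :=
  fun φ v => f (radialRetract R φ) (radialRetract R v)

theorem truncRhs_eq {R : ℝ} (hR : 0 < R) {v : Vec m} (hφ : ‖φ‖ ≤ R) (hv : ‖v‖ ≤ R) :
    truncRhs f R φ v = f φ v := by
  rw [truncRhs, radialRetract_of_norm_le hR hφ, radialRetract_of_norm_le hR hv]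

theorem exists_lip_truncRhs (hf : LipOnBounded f) {R : ℝ} (hR : 0 < R) :
    ∃ L : ℝ, 0 < L ∧ ∀ φ ψ v w,
      ‖truncRhs f R φ v - truncRhs f R ψ w‖ ≤ L * (‖φ - ψ‖ + ‖v - w‖) := by
  obtain ⟨L, hL, h⟩ := hf R hR
  refine ⟨L * 2, by positivity, fun φ ψ v w => (h _ _ _ _ (norm_radialRetract_le hR _)
    (norm_radialRetract_le hR _) (norm_radialRetract_le hR _)
    (norm_radialRetract_le hR _)).trans ?_⟩
  rw [mul_assoc, mul_add 2]
  exact mul_le_mul_of_nonneg_left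
    (add_le_add (norm_radialRetract_sub_le hR _ _) (norm_radialRetract_sub_le hR _ _)) hL.le

theorem lipOnBounded_truncRhs (hf : LipOnBounded f) {R : ℝ} (hR : 0 < R) :
    LipOnBounded (truncRhs f R) := fun _ _ => by
  obtain ⟨L, hL, h⟩ := exists_lip_truncRhs hf hR
  exact ⟨L, hL, fun _ _ _ _ _ _ _ _ => h _ _ _ _⟩

theorem exists_truncRhs_solution (hf : LipOnBounded f) {R : ℝ} (hR : 0 < R)
    (hu : Measurable u) (φ : Hist Δ n) :
    ∃ z, Continuous z ∧ IsSolution Δ (truncRhs f R) u φ ⊤ z := by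
  obtain ⟨L, hL, h⟩ := exists_lip_truncRhs hf hR
  obtain ⟨K, -, hK⟩ := hf.exists_bound R
  obtain ⟨z, hz, h0, hi, he⟩ := exists_global_solution (lipOnBounded_truncRhs hf hR).continuous
    hL.le (fun φ ψ v => by simpa using h φ ψ v v)
    (fun φ v => hK _ _ (norm_radialRetract_le hR φ) (norm_radialRetract_le hR v)) hu φ
  exact ⟨z, hz, EReal.coe_lt_top 0, hz.continuousOn, h0, fun t _ _ => hi t, fun t ht _ => he t ht⟩

namespace IsSolution

theorem continuousOn_Icc (hx : IsSolution Δ f u φ tm x) (hT : (T : EReal) < tm) :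
    ContinuousOn x (Icc (-(Δ : ℝ)) T) :=
  hx.cont.mono fun _ hs => ⟨hs.1, (EReal.coe_le_coe_iff.2 hs.2).trans_lt hT⟩

theorem continuousOn_window (hx : IsSolution Δ f u φ tm x) (hT : (T : EReal) < tm)
    (h0 : 0 ≤ T) : ContinuousOn x (Icc (T - Δ) T) :=
  (hx.continuousOn_Icc hT).mono (Icc_subset_Icc_left (by linarith))

theorem continuousOn_seg (hx : IsSolution Δ f u φ tm x) (hT : (T : EReal) < tm) :
    ContinuousOn (seg Δ x) (Icc 0 T) :=
  _root_.continuousOn_seg (by rw [zero_sub]; exact hx.continuousOn_Icc hT)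

theorem seg_zero (hx : IsSolution Δ f u φ tm x) : seg Δ x 0 = φ := seg_zero_of_init hx.init

theorem exists_bound (hx : IsSolution Δ f u φ tm x) (hT : (T : EReal) < tm) :
    ∃ C : ℝ, ∀ t ∈ Icc (0 : ℝ) T, ‖seg Δ x t‖ ≤ C :=
  isCompact_Icc.exists_bound_of_continuousOn (hx.continuousOn_seg hT)

theorem lt_of_mem (hT : (T : EReal) < tm) {t : ℝ} (ht : t ≤ T) : (t : EReal) < tm :=
  (EReal.coe_le_coe_iff.2 ht).trans_lt hT

/-- A solution stays a solution when the right-hand side agrees along it. -/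
theorem congr_rhs (hx : IsSolution Δ f u φ tm x) (h0 : 0 < tm') (hle : tm' ≤ tm)
    (h : ∀ᵐ s : ℝ, 0 ≤ s → (s : EReal) < tm' → f (seg Δ x s) (u s) = f' (seg Δ x s) (u' s)) :
    IsSolution Δ f' u' φ tm' x := by
  have key : ∀ t : ℝ, 0 ≤ t → (t : EReal) < tm' → ∀ᵐ s, s ∈ uIoc 0 t →
      f (seg Δ x s) (u s) = f' (seg Δ x s) (u' s) := by
    intro t ht htm
    filter_upwards [h] with s hs hst
    rw [uIoc_of_le ht] at hst
    exact hs hst.1.le (lt_of_mem htm hst.2)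
  refine ⟨h0, hx.cont.mono fun s hs => ⟨hs.1, hs.2.trans_le hle⟩, hx.init, fun t ht htm => ?_,
    fun t ht htm => ?_⟩
  · refine (hx.integrable t ht (htm.trans_le hle)).congr_ae ?_
    exact (ae_restrict_iff' measurableSet_uIoc).2 (key t ht htm)
  · rw [hx.integral_eq t ht (htm.trans_le hle), intervalIntegral.integral_congr_ae (key t ht htm)]

/-- Continuous dependence on initial data for solutions in a common ball. -/
theorem norm_seg_sub_le (hx : IsSolution Δ f u φ tm x) (hy : IsSolution Δ f' u' ψ tm' y)
    (hT : (T : EReal) < tm) (hT' : (T : EReal) < tm')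
    (hff : ∀ᵐ s : ℝ, s ∈ Icc 0 T → f (seg Δ x s) (u s) = f' (seg Δ x s) (u' s)) {r L : ℝ}
    (hL : 0 < L)
    (hf' : ∀ (φ₁ φ₂ : Hist Δ n) (v₁ v₂ : Vec k),
      ‖φ₁‖ ≤ r → ‖φ₂‖ ≤ r → ‖v₁‖ ≤ r → ‖v₂‖ ≤ r →
        ‖f' φ₁ v₁ - f' φ₂ v₂‖ ≤ L * (‖φ₁ - φ₂‖ + ‖v₁ - v₂‖))
    (hxr : ∀ s ∈ Icc (0 : ℝ) T, ‖seg Δ x s‖ ≤ r) (hyr : ∀ s ∈ Icc (0 : ℝ) T, ‖seg Δ y s‖ ≤ r)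
    (hur : ∀ᵐ s : ℝ, s ∈ Icc 0 T → ‖u' s‖ ≤ r) :
    ∀ t ∈ Icc (0 : ℝ) T, ‖seg Δ x t - seg Δ y t‖ ≤ ‖φ - ψ‖ * Real.exp (L * t) := by
  intro t ht
  have h0T := ht.1.trans ht.2
  have := norm_seg_sub_le_exp hL.le (hx.continuousOn_Icc hT) (hy.continuousOn_Icc hT')
    (hx.integrable T h0T hT) (hy.integrable T h0T hT')
    (fun t ht => hx.integral_eq t ht.1 (lt_of_mem hT ht.2))
    (fun t ht => hy.integral_eq t ht.1 (lt_of_mem hT' ht.2)) (by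
      filter_upwards [hff, hur] with s h1 h2 hs
      rw [h1 hs]
      simpa using hf' (seg Δ x s) (seg Δ y s) (u' s) (u' s) (hxr s hs) (hyr s hs) (h2 hs) (h2 hs))
    t ht
  rwa [hx.seg_zero, hy.seg_zero] at this

/-- Uniqueness of solutions. -/
theorem eqOn (hx : IsSolution Δ f u φ tm x) (hy : IsSolution Δ f' u' φ tm' y)
    (hT : (T : EReal) < tm) (hT' : (T : EReal) < tm') (hf' : LipOnBounded f')
    (hff : ∀ᵐ s : ℝ, s ∈ Icc 0 T → f (seg Δ x s) (u s) = f' (seg Δ x s) (u' s))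
    (hur : ∃ C : ℝ, ∀ᵐ s : ℝ, s ∈ Icc 0 T → ‖u' s‖ ≤ C) :
    EqOn x y (Icc (-(Δ : ℝ)) T) := by
  obtain ⟨C, hC⟩ := hur
  obtain ⟨C₁, hC₁⟩ := hx.exists_bound hT
  obtain ⟨C₂, hC₂⟩ := hy.exists_bound hT'
  have hr0 : 0 < |C| + |C₁| + |C₂| + 1 := by positivity
  have i0 := abs_nonneg C
  have i1 := abs_nonneg C₁
  have i2 := abs_nonneg C₂
  have j0 := le_abs_self C
  have j1 := le_abs_self C₁
  have j2 := le_abs_self C₂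
  obtain ⟨L, hL, h⟩ := hf' _ hr0
  have key := hx.norm_seg_sub_le hy hT hT' hff hL h (fun s hs => (hC₁ s hs).trans (by linarith))
    (fun s hs => (hC₂ s hs).trans (by linarith)) (by
      filter_upwards [hC] with s h1 hs using (h1 hs).trans (by linarith))
  intro s hs
  rcases le_total 0 s with h0 | h0
  · have := key s ⟨h0, hs.2⟩
    rw [sub_self, norm_zero, zero_mul, norm_le_zero_iff, sub_eq_zero] at this
    rw [← ev0_seg (hx.continuousOn_window (lt_of_mem hT hs.2) h0),
      ← ev0_seg (hy.continuousOn_window (lt_of_mem hT' hs.2) h0), this]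
  · rw [hx.init ⟨s, hs.1, h0⟩, hy.init ⟨s, hs.1, h0⟩]

theorem norm_seg_le (hx : IsSolution Δ f u φ tm x) {B t : ℝ} (hφ : ‖φ‖ ≤ B)
    (h : ∀ s, 0 ≤ s → s ≤ t → ‖x s‖ ≤ B) (ht : 0 ≤ t) : ‖seg Δ x t‖ ≤ B := by
  refine _root_.norm_seg_le ((norm_nonneg _).trans hφ) fun s hs => ?_
  rcases le_total 0 s with h0 | h0
  · exact h s h0 hs.2
  · rw [hx.init ⟨s, by linarith [hs.1], h0⟩]
    exact (φ.norm_coe_le_norm _).trans hφ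

/-- A solution of the truncated equation solves the original one while it is small. -/
theorem of_truncRhs {R T₀ : ℝ} (hR : 0 < R) (hz : IsSolution Δ (truncRhs f R) u φ ⊤ x)
    (hc : Continuous x) (hT₀ : 0 ≤ T₀) (hlt : ∀ s ∈ Icc (0 : ℝ) T₀, ‖seg Δ x s‖ < R)
    (hu : ∀ᵐ s : ℝ, s ∈ Icc 0 (T₀ + 1) → ‖u s‖ ≤ R) :
    ∃ δ : ℝ, 0 < δ ∧ IsSolution Δ f u φ ((T₀ + δ : ℝ) : EReal) x := by
  have hev : ∀ᶠ s in 𝓝 T₀, ‖seg Δ x s‖ < R :=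
    (continuous_seg hc).norm.continuousAt.eventually_lt_const (hlt T₀ ⟨hT₀, le_rfl⟩)
  obtain ⟨ε, hε, hball⟩ := Metric.eventually_nhds_iff.1 hev
  have hδ : 0 < min ε 1 := lt_min hε one_pos
  refine ⟨min ε 1, hδ, hz.congr_rhs (by exact_mod_cast (by linarith : (0 : ℝ) < T₀ + min ε 1))
    le_top ?_⟩
  filter_upwards [hu] with s hs h0 h1
  have h1' : s < T₀ + min ε 1 := by exact_mod_cast h1
  refine truncRhs_eq hR ?_ (hs ⟨h0, by linarith [min_le_right ε 1]⟩)
  rcases le_or_gt s T₀ with h2 | h2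
  · exact (hlt s ⟨h0, h2⟩).le
  · refine (hball ?_).le
    rw [Real.dist_eq, abs_of_pos (by linarith)]
    linarith [min_le_left ε 1]

end IsSolution

theorem IsInput.exists_bound (hu : IsInput u) (T : ℝ) :
    ∃ C : ℝ, ∀ᵐ t : ℝ, t ∈ Icc 0 T → ‖u t‖ ≤ C := by
  obtain ⟨C, hC⟩ := hu.2 (|T| + 1) (by positivity)
  refine ⟨C, ?_⟩
  filter_upwards [hC] with t h ht
  exact h ⟨ht.1, by linarith [ht.2, le_abs_self T]⟩

/-- Every initial segment and input admit a maximal solution. -/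
theorem exists_isMaxSolution (hf : LipOnBounded f) (hu : IsInput u) (φ : Hist Δ n) :
    ∃ tm x, IsMaxSolution Δ f u φ tm x := by
  classical
  have huniq : ∀ {T₁ T₂ : EReal} {y₁ y₂ : ℝ → Vec n}, IsSolution Δ f u φ T₁ y₁ →
      IsSolution Δ f u φ T₂ y₂ → ∀ t : ℝ, -(Δ : ℝ) ≤ t → (t : EReal) < T₁ → (t : EReal) < T₂ →
      y₁ t = y₂ t := by
    intro T₁ T₂ y₁ y₂ h₁ h₂ t ht ht1 ht2
    refine h₁.eqOn h₂ (T := max t 0) ?_ ?_ hf (by simp) (hu.exists_bound _) ⟨ht, le_max_left _ _⟩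
    · rcases max_choice t 0 with h | h <;> rw [h]
      exacts [ht1, h₁.tmax_pos]
    · rcases max_choice t 0 with h | h <;> rw [h]
      exacts [ht2, h₂.tmax_pos]
  obtain ⟨M, hM⟩ := hu.exists_bound 1
  have hR : 0 < ‖φ‖ + |M| + 1 := by positivity
  obtain ⟨z, hzc, hz⟩ := exists_truncRhs_solution hf hR hu.1 φ
  obtain ⟨δ, hδ, hloc⟩ := hz.of_truncRhs hR hzc le_rfl (fun s hs => by
      rw [le_antisymm hs.2 hs.1, hz.seg_zero]; linarith [abs_nonneg M]) (by
      filter_upwards [hM] with s h hs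
      exact (h ⟨hs.1, by linarith [hs.2]⟩).trans (by linarith [le_abs_self M, norm_nonneg φ]))
  let A : Set EReal := {T | ∃ y, IsSolution Δ f u φ T y}
  have hex : ∀ t : ℝ, (t : EReal) < sSup A → ∃ T y, IsSolution Δ f u φ T y ∧ (t : EReal) < T := by
    intro t ht
    obtain ⟨T, ⟨y, hy⟩, htT⟩ := lt_sSup_iff.1 ht
    exact ⟨T, y, hy, htT⟩
  choose! Tc yc hsol hlt using hex
  let X : ℝ → Vec n := fun t => yc t t
  have hX : ∀ {T : EReal} {y : ℝ → Vec n}, IsSolution Δ f u φ T y → ∀ t : ℝ, -(Δ : ℝ) ≤ t →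
      (t : EReal) < T → X t = y t := by
    intro T y hy t ht htT
    have htA : (t : EReal) < sSup A := htT.trans_le (le_sSup ⟨y, hy⟩)
    exact huniq (hsol t htA) hy t ht (hlt t htA) htT
  have hseg : ∀ {T : EReal} {y : ℝ → Vec n}, IsSolution Δ f u φ T y → ∀ t : ℝ, 0 ≤ t →
      (t : EReal) < T → seg Δ X t = seg Δ y t := fun hy t ht htT =>
    seg_congr fun s hs => hX hy s (by linarith [hs.1]) (IsSolution.lt_of_mem htT hs.2)
  have hmem : ∀ t : ℝ, 0 ≤ t → (t : EReal) < sSup A → ∀ s ∈ uIoc 0 t,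
      f (seg Δ (yc t) s) (u s) = f (seg Δ X s) (u s) := by
    intro t ht htA s hs
    rw [uIoc_of_le ht] at hs
    rw [hseg (hsol t htA) s hs.1.le (IsSolution.lt_of_mem (hlt t htA) hs.2)]
  have hpos : (0 : EReal) < sSup A := hloc.tmax_pos.trans_le (le_sSup ⟨z, hloc⟩)
  refine ⟨sSup A, X, ⟨hpos, ?_, fun τ => ?_, fun t ht htA => ?_, fun t ht htA => ?_⟩,
    fun T' y hy _ => le_sSup ⟨y, hy⟩⟩
  · rintro s ⟨hs, hsA⟩
    have h1 := (hsol s hsA).cont s ⟨hs, hlt s hsA⟩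
    have h2 : ContinuousWithinAt X {r : ℝ | -(Δ : ℝ) ≤ r ∧ (r : EReal) < Tc s} s :=
      h1.congr (fun r hr => hX (hsol s hsA) r hr.1 hr.2) (hX (hsol s hsA) s hs (hlt s hsA))
    refine h2.mono_of_mem_nhdsWithin ?_
    have h3 : ∀ᶠ r : ℝ in 𝓝 s, (r : EReal) < Tc s :=
      continuous_coe_real_ereal.continuousAt.eventually_lt_const (hlt s hsA)
    filter_upwards [nhdsWithin_le_nhds h3, self_mem_nhdsWithin] with r hr1 hr2 using ⟨hr2.1, hr1⟩
  · rw [hX hloc τ.1 τ.2.1 ((EReal.coe_le_coe_iff.2 τ.2.2).trans_lt hloc.tmax_pos), hloc.init]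
  · exact ((hsol t htA).integrable t ht (hlt t htA)).congr fun s hs => hmem t ht htA s hs
  · have h0 : X 0 = yc t 0 := hX (hsol t htA) 0 (by simp)
      (IsSolution.lt_of_mem (hlt t htA) ht)
    rw [h0, ← intervalIntegral.integral_congr_ae (Eventually.of_forall (hmem t ht htA))]
    exact (hsol t htA).integral_eq t ht (hlt t htA)

/-- A bounded maximal solution is global. -/
theorem IsMaxSolution.eq_top_of_bounded (hx : IsMaxSolution Δ f u φ tm x) (hf : LipOnBounded f)
    (hu : IsInput u) {B : ℝ} (hB : ∀ t : ℝ, 0 ≤ t → (t : EReal) < tm → ‖x t‖ ≤ B) : tm = ⊤ := by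
  by_contra htop
  obtain ⟨hs, hmax⟩ := hx
  have hpos := hs.tmax_pos
  lift tm to ℝ using ⟨htop, (bot_lt_of_lt hpos).ne'⟩
  have hpos' : 0 < tm := by exact_mod_cast hpos
  obtain ⟨M, hM⟩ := hu.exists_bound (tm + 1)
  have hR : 0 < ‖φ‖ + |B| + |M| + 1 := by positivity
  have hB' : B ≤ ‖φ‖ + |B| := by linarith [le_abs_self B, norm_nonneg φ]
  obtain ⟨z, hzc, hz⟩ := exists_truncRhs_solution hf hR hu.1 φ
  have hsegx : ∀ t : ℝ, 0 ≤ t → t < tm → ‖seg Δ x t‖ ≤ ‖φ‖ + |B| := fun t ht htm =>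
    hs.norm_seg_le (by linarith [abs_nonneg B])
      (fun s h0 hst => (hB s h0 (by exact_mod_cast hst.trans_lt htm)).trans hB') ht
  have heq : ∀ t : ℝ, t < tm → EqOn x z (Icc (-(Δ : ℝ)) t) := by
    intro t htm
    refine hs.eqOn hz (by exact_mod_cast htm) (EReal.coe_lt_top _) (lipOnBounded_truncRhs hf hR)
      ?_ (hu.exists_bound t)
    filter_upwards [hM] with s h1 h2
    refine (truncRhs_eq hR ((hsegx s h2.1 (h2.2.trans_lt htm)).trans ?_)
      ((h1 ⟨h2.1, by linarith [h2.2]⟩).trans ?_)).symm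
    · linarith [abs_nonneg M]
    · linarith [le_abs_self M, abs_nonneg B, norm_nonneg φ]
  have hsegz : ∀ t ∈ Ico (0 : ℝ) tm, ‖seg Δ z t‖ ≤ ‖φ‖ + |B| := by
    intro t ht
    rw [← seg_congr fun s hst => heq t ht.2 ⟨by linarith [hst.1, ht.1], hst.2⟩]
    exact hsegx t ht.1 ht.2
  have hclos : ∀ t ∈ Icc (0 : ℝ) tm, ‖seg Δ z t‖ ≤ ‖φ‖ + |B| := by
    have hcl : IsClosed {t : ℝ | ‖seg Δ z t‖ ≤ ‖φ‖ + |B|} :=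
      isClosed_le (continuous_seg hzc).norm continuous_const
    rw [← closure_Ico hpos'.ne]
    exact fun t ht => closure_minimal hsegz hcl ht
  obtain ⟨δ, hδ, hsol⟩ := hz.of_truncRhs hR hzc hpos'.le
    (fun t ht => (hclos t ht).trans_lt (by linarith [abs_nonneg M])) (by
      filter_upwards [hM] with s h1 h2
      exact (h1 h2).trans (by linarith [le_abs_self M, abs_nonneg B, norm_nonneg φ]))
  have := hmax _ z hsol fun t h1 h2 => (heq t (by exact_mod_cast h2) ⟨h1, le_rfl⟩).symm
  have : tm + δ ≤ tm := by exact_mod_cast this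
  linarith

theorem seg_comp_add (x : ℝ → Vec n) (h t : ℝ) :
    seg Δ (fun s => x (s + h)) t = seg Δ x (t + h) := by
  have key : ContinuousOn (fun s => x (s + h)) (Icc (t - Δ) t) ↔
      ContinuousOn x (Icc (t + h - Δ) (t + h)) := by
    constructor
    · intro hc
      have := hc.comp (t := Icc (t - Δ) t) (s := Icc (t + h - Δ) (t + h)) (f := fun s => s - h)
        (by fun_prop) fun s hs => ⟨by linarith [hs.1], by linarith [hs.2]⟩
      simpa [Function.comp_def] using this
    · intro hc
      exact hc.comp (by fun_prop) fun s hs => ⟨by linarith [hs.1], by linarith [hs.2]⟩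
  by_cases hc : ContinuousOn x (Icc (t + h - Δ) (t + h))
  · ext1 τ
    rw [seg_apply hc, seg_apply (key.2 hc)]
    ring_nf
  · have hc' := fun h' => hc (key.1 h')
    rw [seg, seg, dif_neg hc', dif_neg hc]

theorem IsSolution.shift (hx : IsSolution Δ f u φ ⊤ x) {h : ℝ} (hh : 0 ≤ h) :
    IsSolution Δ f (fun s => u (s + h)) (seg Δ x h) ⊤ fun s => x (s + h) := by
  have hint : ∀ t : ℝ, 0 ≤ t →
      IntervalIntegrable (fun s => f (seg Δ x s) (u s)) volume h (t + h) := fun t ht =>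
    (hx.integrable h hh (EReal.coe_lt_top _)).symm.trans
      (hx.integrable (t + h) (by linarith) (EReal.coe_lt_top _))
  refine ⟨EReal.coe_lt_top 0, ?_, fun τ => ?_, fun t ht _ => ?_, fun t ht _ => ?_⟩
  · refine hx.cont.comp (by fun_prop) fun s hs => ⟨by linarith [hs.1], EReal.coe_lt_top _⟩
  · rw [seg_apply (hx.continuousOn_window (EReal.coe_lt_top _) hh), add_comm]
  · simp_rw [seg_comp_add]
    have := (hint t ht).comp_add_right h
    simpa using this
  · simp_rw [seg_comp_add]
    rw [intervalIntegral.integral_comp_add_right (fun s => f (seg Δ x s) (u s)), zero_add,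
      hx.integral_eq (t + h) (by linarith) (EReal.coe_lt_top _),
      hx.integral_eq h hh (EReal.coe_lt_top _), add_assoc,
      intervalIntegral.integral_add_adjacent_intervals
        (hx.integrable h hh (EReal.coe_lt_top _)) (hint t ht)]

section EssBnd

theorem essBnd_nonneg (u : ℝ → Vec m) (s : Set ℝ) : 0 ≤ essBnd u s :=
  Real.sInf_nonneg fun _ h => h.1

theorem essBnd_le {s : Set ℝ} {C : ℝ} (hC : 0 ≤ C) (h : ∀ᵐ τ : ℝ, τ ∈ s → ‖u τ‖ ≤ C) :
    essBnd u s ≤ C :=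
  csInf_le ⟨0, fun _ h => h.1⟩ ⟨hC, h⟩

theorem IsInput.ae_norm_le_essBnd (hu : IsInput u) (T : ℝ) :
    ∀ᵐ t : ℝ, t ∈ Icc 0 T → ‖u t‖ ≤ essBnd u (Icc 0 T) := by
  obtain ⟨C, hC⟩ := hu.exists_bound T
  have hne : {C : ℝ | 0 ≤ C ∧ ∀ᵐ τ ∂volume, τ ∈ Icc 0 T → ‖u τ‖ ≤ C}.Nonempty :=
    ⟨|C|, abs_nonneg _, by filter_upwards [hC] with t h ht using (h ht).trans (le_abs_self C)⟩
  have hk : ∀ j : ℕ, ∀ᵐ t : ℝ, t ∈ Icc 0 T → ‖u t‖ ≤ essBnd u (Icc 0 T) + 1 / (j + 1) := by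
    intro j
    obtain ⟨c, hc, hlt⟩ := exists_lt_of_csInf_lt hne
      (lt_add_of_pos_right (essBnd u (Icc 0 T)) (Nat.one_div_pos_of_nat (n := j)))
    filter_upwards [hc.2] with t h ht using (h ht).trans hlt.le
  filter_upwards [ae_all_iff.2 hk] with t h ht
  refine le_of_forall_pos_le_add fun ε hε => ?_
  obtain ⟨j, hj⟩ := exists_nat_one_div_lt hε
  exact (h j ht).trans (by linarith)

theorem IsInput.essBnd_mono (hu : IsInput u) {t T : ℝ} (h : t ≤ T) :
    essBnd u (Icc 0 t) ≤ essBnd u (Icc 0 T) := by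
  refine essBnd_le (essBnd_nonneg _ _) ?_
  filter_upwards [hu.ae_norm_le_essBnd T] with s hs hst using hs ⟨hst.1, hst.2.trans h⟩

end EssBnd
end Solutions

section Driver
variable {Δ : ℝ≥0} {n : ℕ} {V : Hist Δ n → ℝ} {φ : Hist Δ n} {w w' : Vec n} {c : ℝ}

theorem driverD_le_of_eventually
    (h : ∀ ε : ℝ, 0 < ε → ∀ᶠ h in 𝓝[>] (0 : ℝ), V (shiftSeg φ w h) ≤ V φ + (c + ε) * h) :
    driverD V φ w ≤ (c : EReal) := by
  refine EReal.le_of_forall_lt_iff_le.1 fun z hz => ?_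
  have hz' : c < z := EReal.coe_lt_coe_iff.1 hz
  refine limsup_le_of_le (by isBoundedDefault) ?_
  filter_upwards [h (z - c) (sub_pos.2 hz'), self_mem_nhdsWithin] with h hh h0
  rw [EReal.coe_le_coe_iff, div_le_iff₀ h0]
  linarith

theorem eventually_of_driverD_le (h : driverD V φ w ≤ (c : EReal)) {ε : ℝ} (hε : 0 < ε) :
    ∀ᶠ h in 𝓝[>] (0 : ℝ), V (shiftSeg φ w h) ≤ V φ + (c + ε) * h := by
  have h1 : driverD V φ w < ((c + ε : ℝ) : EReal) :=
    h.trans_lt (EReal.coe_lt_coe_iff.2 (by linarith))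
  filter_upwards [eventually_lt_of_limsup_lt h1, self_mem_nhdsWithin] with h hh h0
  have := (div_lt_iff₀ (mem_Ioi.1 h0)).1 (EReal.coe_lt_coe_iff.1 hh)
  linarith

theorem norm_shiftSeg_le {h : ℝ} (hh : 0 ≤ h) : ‖shiftSeg φ w h‖ ≤ ‖φ‖ + h * ‖w‖ := by
  rw [ContinuousMap.norm_le _ (by positivity)]
  intro τ
  refine (norm_add_le _ _).trans (add_le_add (φ.norm_coe_le_norm _) ?_)
  rw [norm_smul, Real.norm_of_nonneg (le_max_right _ _)]
  exact mul_le_mul_of_nonneg_right (max_le (by linarith [τ.2.2]) hh) (norm_nonneg _)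

theorem norm_shiftSeg_sub_le {h : ℝ} (hh : 0 ≤ h) :
    ‖shiftSeg φ w h - shiftSeg φ w' h‖ ≤ h * ‖w - w'‖ := by
  rw [ContinuousMap.norm_le _ (by positivity)]
  intro τ
  simp only [shiftSeg, ContinuousMap.sub_apply, ContinuousMap.coe_mk, add_sub_add_left_eq_sub,
    ← smul_sub]
  rw [norm_smul, Real.norm_of_nonneg (le_max_right _ _)]
  exact mul_le_mul_of_nonneg_right (max_le (by linarith [τ.2.2]) hh) (norm_nonneg _)

theorem eventually_norm_shiftSeg_le (φ : Hist Δ n) (w : Vec n) {b : ℝ} (hb : 0 < b) :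
    ∀ᶠ h in 𝓝[>] (0 : ℝ), ‖shiftSeg φ w h‖ ≤ ‖φ‖ + b := by
  have : Tendsto (fun h : ℝ => ‖φ‖ + h * ‖w‖) (𝓝 0) (𝓝 (‖φ‖ + 0 * ‖w‖)) :=
    Continuous.tendsto (by fun_prop) 0
  filter_upwards [nhdsWithin_le_nhds (this.eventually_lt_const
    (by linarith : ‖φ‖ + 0 * ‖w‖ < ‖φ‖ + b)), self_mem_nhdsWithin] with h hh h0
  exact (norm_shiftSeg_le (le_of_lt h0)).trans hh.le

theorem driverD_le_add (h : driverD V φ w ≤ (c : EReal)) {L : ℝ}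
    (hL : ∀ φ₁ φ₂ : Hist Δ n, ‖φ₁‖ ≤ ‖φ‖ + 1 → ‖φ₂‖ ≤ ‖φ‖ + 1 →
      |V φ₁ - V φ₂| ≤ L * ‖φ₁ - φ₂‖) (hL0 : 0 ≤ L) :
    driverD V φ w' ≤ ((c + L * ‖w' - w‖ : ℝ) : EReal) := by
  refine driverD_le_of_eventually fun ε hε => ?_
  filter_upwards [eventually_of_driverD_le h hε, eventually_norm_shiftSeg_le φ w one_pos,
    eventually_norm_shiftSeg_le φ w' one_pos, self_mem_nhdsWithin] with h h1 h2 h3 h0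
  have h4 := (abs_le.1 (hL _ _ h3 h2)).2
  have h5 := mul_le_mul_of_nonneg_left (norm_shiftSeg_sub_le (φ := φ) (w := w') (w' := w)
    (le_of_lt h0)) hL0
  nlinarith

/-- Along a differentiable trajectory, the deformed history approximates the true one. -/
theorem eventually_norm_seg_sub_shiftSeg_le {x : ℝ → Vec n} {t δ : ℝ} (hδ : 0 < δ)
    (hx : ContinuousOn x (Icc (t - Δ) (t + δ))) (hd : HasDerivWithinAt x w (Ici t) t) {ε : ℝ}
    (hε : 0 < ε) :
    ∀ᶠ h in 𝓝[>] (0 : ℝ), ‖seg Δ x (t + h) - shiftSeg (seg Δ x t) w h‖ ≤ ε * h := by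
  have h1 := hd.isLittleO.def hε
  obtain ⟨η, hη, hb⟩ := Metric.mem_nhdsWithin_iff.1 h1
  have hΔ := Δ.coe_nonneg
  filter_upwards [Ioo_mem_nhdsGT (lt_min hη hδ)] with h hh
  obtain ⟨h0, hlt⟩ := hh
  have hhη := hlt.trans_le (min_le_left _ _)
  have hhδ := hlt.trans_le (min_le_right _ _)
  have c1 : ContinuousOn x (Icc (t + h - Δ) (t + h)) :=
    hx.mono (Icc_subset_Icc (by linarith) (by linarith))
  have c2 : ContinuousOn x (Icc (t - Δ) t) := hx.mono (Icc_subset_Icc le_rfl (by linarith))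
  rw [ContinuousMap.norm_le _ (by positivity)]
  intro τ
  have hτ := τ.2
  rw [ContinuousMap.sub_apply, seg_apply c1]
  simp only [shiftSeg, ContinuousMap.coe_mk]
  rcases le_or_gt (τ.1 + h) 0 with hn | hp
  · rw [projIcc_of_mem _ (⟨by linarith [hτ.1], hn⟩ : τ.1 + h ∈ Icc (-(Δ : ℝ)) 0), seg_apply c2,
      max_eq_right (by linarith), zero_smul, add_zero,
      show t + (τ.1 + h) = t + h + τ.1 by ring, sub_self, norm_zero]
    positivity
  · rw [projIcc_of_right_le _ hp.le, seg_apply c2, max_eq_left (by linarith), add_zero]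
    have := hb ⟨(by
      rw [Metric.mem_ball, Real.dist_eq, abs_of_pos] <;> linarith [hτ.2] :
        t + h + τ.1 ∈ Metric.ball t η), (by rw [mem_Ici]; linarith)⟩
    rw [mem_ofPred_eq, show t + h + τ.1 - t = h + τ.1 by ring, Real.norm_of_nonneg (by linarith),
      sub_sub] at this
    exact this.trans (mul_le_mul_of_nonneg_left (by linarith [hτ.2]) hε.le)

theorem eventually_abs_sub_shiftSeg_le (hV : LipOnBoundedV V) {x : ℝ → Vec n} {t δ : ℝ}
    (hδ : 0 < δ) (hx : ContinuousOn x (Icc (t - Δ) (t + δ)))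
    (hd : HasDerivWithinAt x w (Ici t) t) {ε : ℝ} (hε : 0 < ε) :
    ∀ᶠ h in 𝓝[>] (0 : ℝ), |V (seg Δ x (t + h)) - V (shiftSeg (seg Δ x t) w h)| ≤ ε * h := by
  obtain ⟨L, hL, hLip⟩ := hV (‖seg Δ x t‖ + 2) (by positivity)
  filter_upwards [eventually_norm_seg_sub_shiftSeg_le hδ hx hd (div_pos hε hL),
    eventually_norm_seg_sub_shiftSeg_le hδ hx hd one_pos, Ioo_mem_nhdsGT (zero_lt_one (α := ℝ)),
    eventually_norm_shiftSeg_le (seg Δ x t) w one_pos] with h h1 h2 h3 h4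
  have h5 : ‖seg Δ x (t + h)‖ ≤ ‖seg Δ x t‖ + 2 := by
    have := norm_le_insert' (seg Δ x (t + h)) (shiftSeg (seg Δ x t) w h)
    linarith [h3.2]
  calc _ ≤ L * ‖seg Δ x (t + h) - shiftSeg (seg Δ x t) w h‖ :=
        hLip _ _ h5 (by linarith)
    _ ≤ L * (ε / L * h) := by gcongr
    _ = ε * h := by field_simp

theorem eventually_le_of_driverD_le (hV : LipOnBoundedV V) {x : ℝ → Vec n} {t δ : ℝ}
    (hδ : 0 < δ) (hx : ContinuousOn x (Icc (t - Δ) (t + δ)))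
    (hd : HasDerivWithinAt x w (Ici t) t) (h : driverD V (seg Δ x t) w ≤ (c : EReal)) {ε : ℝ}
    (hε : 0 < ε) :
    ∀ᶠ h in 𝓝[>] (0 : ℝ), V (seg Δ x (t + h)) ≤ V (seg Δ x t) + (c + ε) * h := by
  filter_upwards [eventually_abs_sub_shiftSeg_le hV hδ hx hd (half_pos hε),
    eventually_of_driverD_le h (half_pos hε)] with h h1 h2
  linarith [(abs_le.1 h1).2]

theorem driverD_le_of_seg (hV : LipOnBoundedV V) {x : ℝ → Vec n} {t δ : ℝ}
    (hδ : 0 < δ) (hx : ContinuousOn x (Icc (t - Δ) (t + δ)))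
    (hd : HasDerivWithinAt x w (Ici t) t)
    (h : ∀ ε : ℝ, 0 < ε →
      ∀ᶠ h in 𝓝[>] (0 : ℝ), V (seg Δ x (t + h)) ≤ V (seg Δ x t) + (c + ε) * h) :
    driverD V (seg Δ x t) w ≤ (c : EReal) := by
  refine driverD_le_of_eventually fun ε hε => ?_
  filter_upwards [eventually_abs_sub_shiftSeg_le hV hδ hx hd (half_pos hε),
    h _ (half_pos hε)] with h h1 h2
  linarith [(abs_le.1 h1).1]

end Driver

/-- A Lipschitz function whose upper right derivative is a.e. at most `-a`. -/
theorem LipschitzOnWith.le_sub_mul_of_ae_dini {v : ℝ → ℝ} {K : ℝ≥0} {s t a : ℝ} (hst : s ≤ t)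
    (hv : LipschitzOnWith K v (Icc s t))
    (h : ∀ᵐ r : ℝ, r ∈ Ioo s t → ∀ ε : ℝ, 0 < ε →
      ∀ᶠ h in 𝓝[>] (0 : ℝ), v (r + h) ≤ v r + (-a + ε) * h) :
    v t ≤ v s - a * (t - s) := by
  have hac : AbsolutelyContinuousOnInterval v s t :=
    LipschitzOnWith.absolutelyContinuousOnInterval (by rwa [uIcc_of_le hst])
  have hder : ∀ᵐ r ∂volume.restrict (Ioo s t), deriv v r ≤ -a := by
    rw [ae_restrict_iff' measurableSet_Ioo]
    filter_upwards [hac.ae_differentiableAt, h] with r h1 h2 hr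
    have hd := (h1 (by rw [uIcc_of_le hst]; exact Ioo_subset_Icc_self hr)).hasDerivAt
    have hlim : Tendsto (fun h : ℝ => h⁻¹ • (v (r + h) - v r)) (𝓝[>] 0) (𝓝 (deriv v r)) :=
      hd.tendsto_slope_zero.mono_left (nhdsWithin_mono _ fun x hx => ne_of_gt hx)
    refine le_of_forall_pos_le_add fun ε hε => le_of_tendsto hlim ?_
    filter_upwards [h2 hr ε hε, self_mem_nhdsWithin] with h h3 h0
    have h0' : 0 < h := h0
    rw [smul_eq_mul, inv_mul_le_iff₀ h0']
    linarith
  have hi : ∫ r in s..t, deriv v r ≤ ∫ _ in s..t, -a := by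
    refine intervalIntegral.integral_mono_ae_restrict hst hac.intervalIntegrable_deriv
      intervalIntegrable_const ?_
    rwa [← restrict_Ioo_eq_restrict_Icc]
  rw [hac.integral_deriv_eq_sub, intervalIntegral.integral_const, smul_eq_mul] at hi
  linarith

section Comparison
variable {α χ σ : ℝ → ℝ}

theorem ClassK.nonneg (h : ClassK α) {s : ℝ} (hs : 0 ≤ s) : 0 ≤ α s := by
  have := h.2.1.monotoneOn self_mem_Ici (mem_Ici.2 hs) hs
  rwa [h.2.2] at this

theorem ClassK.pos (h : ClassK α) {s : ℝ} (hs : 0 < s) : 0 < α s := by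
  have := h.2.1 self_mem_Ici (mem_Ici.2 hs.le) hs
  rwa [h.2.2] at this

theorem ClassK.mono (h : ClassK α) {s t : ℝ} (hs : 0 ≤ s) (hst : s ≤ t) : α s ≤ α t :=
  h.2.1.monotoneOn (mem_Ici.2 hs) (mem_Ici.2 (hs.trans hst)) hst

theorem ClassN.nonneg (h : ClassN χ) {s : ℝ} (hs : 0 ≤ s) : 0 ≤ χ s := by
  have := h.2.1 self_mem_Ici (mem_Ici.2 hs) hs
  rwa [h.2.2] at this

theorem ClassN.mono (h : ClassN χ) {s t : ℝ} (hs : 0 ≤ s) (hst : s ≤ t) : χ s ≤ χ t :=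
  h.2.1 (mem_Ici.2 hs) (mem_Ici.2 (hs.trans hst)) hst

theorem ClassK.classN (h : ClassK α) : ClassN α := ⟨h.1, h.2.1.monotoneOn, h.2.2⟩

theorem ClassN.comp (h : ClassN α) (h' : ClassN χ) : ClassN (α ∘ χ) :=
  ⟨h.1.comp h'.1 fun _ hs => h'.nonneg hs,
    h.2.1.comp h'.2.1 fun _ hs => h'.nonneg hs, by simp [h'.2.2, h.2.2]⟩

theorem ClassKinf.comp (h : ClassKinf α) (h' : ClassKinf σ) : ClassKinf (α ∘ σ) :=
  ⟨⟨h.1.1.comp h'.1.1 fun _ hs => h'.1.nonneg hs,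
    h.1.2.1.comp h'.1.2.1 fun _ hs => h'.1.nonneg hs, by simp [h'.1.2.2, h.1.2.2]⟩,
    h.2.comp h'.2⟩

theorem ClassN.add_id (h : ClassN χ) : ClassKinf fun s => χ s + s := by
  refine ⟨⟨h.1.add continuousOn_id, h.2.1.add_strictMono fun _ _ _ _ hst => hst, ?_⟩, ?_⟩
  · simp [h.2.2]
  · refine tendsto_atTop_mono' _ ?_ tendsto_id
    filter_upwards [eventually_ge_atTop 0] with s hs
    have := h.nonneg hs
    simpa using this

theorem ClassKinf.exists_inverse (h : ClassKinf α) :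
    ∃ κ : ℝ → ℝ, ClassKinf κ ∧ (∀ s, 0 ≤ s → α (κ s) = s) ∧ ∀ s, 0 ≤ s → κ (α s) = s := by
  obtain ⟨⟨hc, hm, h0⟩, hlim⟩ := h
  let g : ℝ → ℝ := fun s => α (max s 0) + min s 0
  have hg : ∀ s, 0 ≤ s → g s = α s := fun s hs => by simp [g, hs]
  have hgm : StrictMono g := by
    intro s t hst
    have h1 : α (max s 0) ≤ α (max t 0) :=
      hm.monotoneOn (mem_Ici.2 (le_max_right _ _)) (mem_Ici.2 (le_max_right _ _)) (max_le_max hst.le le_rfl)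
    rcases lt_or_ge s 0 with hs | hs
    · refine add_lt_add_of_le_of_lt h1 ?_
      rw [min_eq_left hs.le]
      exact lt_min hst hs
    · rw [hg s hs, hg t (hs.trans hst.le)]
      exact hm (mem_Ici.2 hs) (mem_Ici.2 (hs.trans hst.le)) hst
  have hgc : Continuous g :=
    (hc.comp_continuous (continuous_id.max continuous_const) fun s => mem_Ici.2 (le_max_right _ _)).add
      (continuous_id.min continuous_const)
  have htop : Tendsto g atTop atTop := hlim.congr' (by
    filter_upwards [eventually_ge_atTop 0] with s hs using (hg s hs).symm)
  have hbot : Tendsto g atBot atBot := tendsto_id.congr' (by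
    filter_upwards [eventually_le_atBot 0] with s hs
    simp [g, hs, h0])
  let e := hgm.orderIsoOfSurjective g (hgc.surjective htop hbot)
  have he0 : e.symm 0 = 0 := by
    rw [OrderIso.symm_apply_eq]
    change 0 = g 0
    rw [hg 0 le_rfl, h0]
  have hnn : ∀ s, 0 ≤ s → 0 ≤ e.symm s := fun s hs => by
    rw [← he0]; exact e.symm.monotone hs
  refine ⟨e.symm, ⟨⟨e.symm.continuous.continuousOn, e.symm.strictMono.strictMonoOn _, he0⟩,
    e.symm.tendsto_atTop⟩, fun s hs => ?_, fun s hs => ?_⟩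
  · rw [← hg _ (hnn s hs)]
    exact e.apply_symm_apply s
  · rw [← hg s hs]
    exact e.symm_apply_apply s

/-- A monotone factor times the identity is dominated by a function of class `𝒦∞`. -/
theorem exists_classKinf_mul_le {g : ℝ → ℝ} (hg : Monotone g) (hg0 : ∀ s, 0 ≤ g s) :
    ∃ κ, ClassKinf κ ∧ ∀ s, 0 ≤ s → g s * s ≤ κ s := by
  have hi : ∀ a b, IntervalIntegrable g volume a b := fun a b => hg.intervalIntegrable
  let G : ℝ → ℝ := fun s => ∫ r in (0 : ℝ)..1, g (r + s)
  have hGc : Continuous G := by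
    have : G = fun s => (∫ r in (0 : ℝ)..(1 + s), g r) - ∫ r in (0 : ℝ)..s, g r := by
      funext s
      simp only [G]
      rw [intervalIntegral.integral_comp_add_right (fun r => g r), zero_add,
        intervalIntegral.integral_interval_sub_left (hi _ _) (hi _ _)]
    rw [this]
    have hp := intervalIntegral.continuous_primitive hi 0
    exact (hp.comp (continuous_const.add continuous_id)).sub hp
  have hi' : ∀ s, IntervalIntegrable (fun r => g (r + s)) volume 0 1 := fun s =>
    (hg.comp (fun _ _ h => add_le_add_left h s)).intervalIntegrable
  have hGm : Monotone G := fun s t hst =>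
    intervalIntegral.integral_mono_on zero_le_one (hi' s) (hi' t) fun r _ => hg (by linarith)
  have hle : ∀ s, g s ≤ G s := fun s => by
    have := intervalIntegral.integral_mono_on (a := 0) (b := 1) zero_le_one
      (intervalIntegrable_const (c := g s)) (hi' s) fun r hr => hg (by linarith [hr.1])
    rwa [intervalIntegral.integral_const, sub_zero, one_smul] at this
  have hN : ClassN fun s => G s * s := by
    refine ⟨(hGc.mul continuous_id).continuousOn, fun s hs t ht hst => ?_, by simp⟩
    exact mul_le_mul (hGm hst) hst hs ((hg0 t).trans (hle t))
  refine ⟨_, hN.add_id, fun s hs => ?_⟩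
  have := mul_le_mul_of_nonneg_right (hle s) hs
  linarith

/-- A bound available on each bounded range can be chosen monotonically. -/
theorem exists_monotone_bound {P : ℝ → ℝ → Prop} (h : ∀ r, 0 < r → ∃ L, 0 < L ∧ P r L)
    (hup : ∀ r L L', P r L → L ≤ L' → P r L') (hdown : ∀ r r' L, P r L → r' ≤ r → P r' L) :
    ∃ L : ℝ → ℝ, Monotone L ∧ (∀ r, 0 < L r) ∧ ∀ r, P r (L r) := by
  choose! ℓ hℓ hP using h
  have hpos : ∀ k : ℕ, 0 < ℓ (k + 1) := fun k => hℓ _ (by positivity)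
  refine ⟨fun r => ∑ k ∈ Finset.range (⌈r⌉₊ + 1), ℓ (k + 1), fun r s hrs => ?_, fun r => ?_,
    fun r => ?_⟩
  · exact Finset.sum_le_sum_of_subset_of_nonneg
      (Finset.range_mono (Nat.succ_le_succ (Nat.ceil_mono hrs))) fun k _ _ => (hpos k).le
  · exact Finset.sum_pos (fun k _ => hpos k) ⟨0, by simp⟩
  · refine hup _ (ℓ (⌈r⌉₊ + 1)) _ (hdown _ _ _ (hP (⌈r⌉₊ + 1) (by positivity))
      ((Nat.le_ceil r).trans (by linarith))) ?_
    exact Finset.single_le_sum (f := fun k : ℕ => ℓ (k + 1)) (fun k _ => (hpos k).le)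
      (Finset.self_mem_range_succ _)

/-- A uniform bound together with uniform attraction times yields a `𝒦ℒ` estimate. -/
theorem exists_classKL_of_attraction (hσ : ClassK σ) (T : ℝ → ℝ → ℝ) :
    ∃ β, ClassKL β ∧ ∀ s t y, 0 ≤ s → 0 ≤ t → 0 ≤ y → y ≤ σ s →
      (∀ r ε, s ≤ r → 0 < ε → T r ε ≤ t → y ≤ ε) → y ≤ β s t := by
  let A : Set (ℝ × ℝ × ℝ) := {p | 0 ≤ p.2.2 ∧
    ∀ r ε, p.1 ≤ r → 0 < ε → T r ε ≤ p.2.1 → p.2.2 ≤ ε}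
  let e : ℝ → ℝ := fun y => √y / (1 + y)
  have he0 : ∀ y, 0 ≤ y → 0 ≤ e y := fun y hy => by positivity
  have he1 : ∀ y, 0 ≤ y → e y ≤ 1 := fun y hy => by
    rw [div_le_one (by positivity)]
    nlinarith [Real.sq_sqrt hy, sq_nonneg (√y - 1)]
  let F : ℝ → ℝ → A → ℝ := fun s t p => e p.1.2.2 - max (p.1.1 - s) 0 - max (t - p.1.2.1) 0
  let H : ℝ → ℝ → ℝ := fun s t => ⨆ p, F s t p
  have hF1 : ∀ s t p, F s t p ≤ 1 := fun s t p => by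
    have := he1 _ p.2.1
    simp only [F]
    linarith [le_max_right (p.1.1 - s) 0, le_max_right (t - p.1.2.1) 0]
  have hbdd : ∀ s t, BddAbove (range (F s t)) := fun s t => ⟨1, by
    rintro _ ⟨p, rfl⟩; exact hF1 s t p⟩
  have hzero : ∀ s t, ((s, t, 0) : ℝ × ℝ × ℝ) ∈ A := fun s t =>
    ⟨le_rfl, fun _ _ _ hε _ => hε.le⟩
  have hle : ∀ s t p, F s t p ≤ H s t := fun s t p => le_ciSup (hbdd s t) p
  have hsup : ∀ s t c, (∀ p, F s t p ≤ c) → H s t ≤ c := fun s t c h =>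
    haveI : Nonempty A := ⟨⟨_, hzero s t⟩⟩
    ciSup_le h
  have hH0 : ∀ s t, 0 ≤ H s t := fun s t => by
    have := hle s t ⟨_, hzero s t⟩
    simpa [F, e] using this
  have hHs : ∀ t, Monotone fun s => H s t := fun t s s' hss' => by
    refine hsup _ _ _ fun p => le_trans ?_ (hle s' t p)
    have : max (p.1.1 - s') 0 ≤ max (p.1.1 - s) 0 := max_le_max (by linarith) le_rfl
    simp only [F]
    linarith
  have hHt : ∀ s, Antitone (H s) := fun s t t' htt' => by
    refine hsup _ _ _ fun p => le_trans ?_ (hle s t p)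
    have : max (t - p.1.2.1) 0 ≤ max (t' - p.1.2.1) 0 := max_le_max (by linarith) le_rfl
    simp only [F]
    linarith
  have hmax : ∀ a b c : ℝ, a ≤ b + |c| → max a 0 ≤ max b 0 + |c| := fun a b c h =>
    max_le (h.trans (by linarith [le_max_left b 0]))
      (by linarith [le_max_right b 0, abs_nonneg c])
  have hHsc : ∀ t, Continuous fun s => H s t := fun t => by
    refine (LipschitzWith.of_le_add fun s s' => hsup _ _ _ fun p => ?_).continuous
    have h1 := hle s' t p
    have h2 := hmax (p.1.1 - s') (p.1.1 - s) (s - s') (by linarith [le_abs_self (s - s')])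
    rw [Real.dist_eq]
    simp only [F] at h1 ⊢
    linarith
  have hHtc : ∀ s, Continuous (H s) := fun s => by
    refine (LipschitzWith.of_le_add fun t t' => hsup _ _ _ fun p => ?_).continuous
    have h1 := hle s t' p
    have h2 := hmax (t' - p.1.2.1) (t - p.1.2.1) (t - t') (by linarith [neg_abs_le (t - t')])
    rw [Real.dist_eq]
    simp only [F] at h1 ⊢
    linarith
  have hHlim : ∀ s, Tendsto (H s) atTop (𝓝 0) := fun s => by
    refine Metric.tendsto_nhds.2 fun ε hε => ?_
    filter_upwards [eventually_ge_atTop (T (s + 1) ((ε / 2) ^ 2) + 1)] with t ht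
    rw [Real.dist_0_eq_abs, abs_of_nonneg (hH0 s t)]
    refine (hsup _ _ (ε / 2) fun p => ?_).trans_lt (half_lt_self hε)
    have hy := p.2.1
    have e1 := he1 _ hy
    simp only [F]
    rcases le_or_gt p.1.1 (s + 1) with hs | hs
    · rcases le_or_gt (t - 1) p.1.2.1 with ht' | ht'
      · have hyε := p.2.2 (s + 1) ((ε / 2) ^ 2) hs (by positivity) (by linarith)
        have : e p.1.2.2 ≤ ε / 2 :=
          (div_le_self (Real.sqrt_nonneg _) (by linarith)).trans
            ((Real.sqrt_le_left (by positivity)).2 hyε)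
        linarith [le_max_right (p.1.1 - s) 0, le_max_right (t - p.1.2.1) 0]
      · linarith [le_max_right (p.1.1 - s) 0, le_max_left (t - p.1.2.1) 0]
    · linarith [le_max_left (p.1.1 - s) 0, le_max_right (t - p.1.2.1) 0]
  let q : ℝ → ℝ := fun s => (1 + σ s) * √(σ s)
  have hq0 : ∀ s, 0 ≤ s → 0 ≤ q s := fun s hs =>
    mul_nonneg (by linarith [hσ.nonneg hs]) (Real.sqrt_nonneg _)
  refine ⟨fun s t => q s * (H s t + Real.exp (-t)), ⟨fun t _ => ⟨?_, ?_, ?_⟩,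
    fun s hs => ⟨?_, ?_, ?_⟩⟩, ?_⟩
  · exact ((continuousOn_const.add hσ.1).mul (Real.continuous_sqrt.comp_continuousOn hσ.1)).mul
      ((hHsc t).add continuous_const).continuousOn
  · intro s hs s' hs' hss'
    have h1 := hσ.2.1 hs hs' hss'
    have h0 := hσ.nonneg hs
    have h2 : q s < q s' := mul_lt_mul' (by linarith) (Real.sqrt_lt_sqrt h0 h1)
      (Real.sqrt_nonneg _) (by linarith)
    exact mul_lt_mul h2 (by linarith [hHs t hss'.le])
      (by linarith [hH0 s t, Real.exp_pos (-t)]) (hq0 s' hs')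
  · simp [q, hσ.2.2]
  · exact (continuous_const.mul ((hHtc s).add (Real.continuous_exp.comp continuous_neg))).continuousOn
  · intro t _ t' _ htt'
    exact mul_le_mul_of_nonneg_left
      (add_le_add (hHt s htt') (Real.exp_le_exp.2 (neg_le_neg htt'))) (hq0 s hs)
  · have := ((hHlim s).add Real.tendsto_exp_neg_atTop_nhds_zero).const_mul (q s)
    simpa using this
  · intro s t y hs ht hy hyσ hatt
    have h1 : e y ≤ H s t := by
      have := hle s t ⟨(s, t, y), hy, hatt⟩
      simpa [F] using this
    calc y = (1 + y) * √y * e y := by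
          simp only [e]
          field_simp
          rw [Real.sq_sqrt hy]
      _ ≤ q s * (H s t + Real.exp (-t)) := by
          refine mul_le_mul ?_ (by linarith [Real.exp_pos (-t)]) (he0 y hy) (hq0 s hs)
          exact mul_le_mul (by linarith) (Real.sqrt_le_sqrt hyσ) (Real.sqrt_nonneg _)
            (by linarith [hσ.nonneg hs])

end Comparison

section LKFImplications
variable {Δ : ℝ≥0} {n m : ℕ} {f : Hist Δ n → Vec m → Vec n} {V : Hist Δ n → ℝ} {α γ : ℝ → ℝ}

theorem IsCoerciveLKF.isLKF (hV : IsCoerciveLKF V) : IsLKF V := by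
  obtain ⟨h0, hL, α₁, α₂, h1, h2, h⟩ := hV
  exact ⟨h0, hL, α₁, α₂, h1, h2, fun φ =>
    ⟨(h1.1.mono (norm_nonneg _) (norm_ev0_le φ)).trans (h φ).1, (h φ).2⟩⟩

theorem IsCoerciveLKF.exists_driverD_le_of_norm (hV : IsCoerciveLKF V) (hα : ClassKinf α)
    (h : ∀ (φ : Hist Δ n) (v : Vec m), driverD V φ (f φ v) ≤ ((-α ‖φ‖ + γ ‖v‖ : ℝ) : EReal)) :
    ∃ α' : ℝ → ℝ, ClassKinf α' ∧
      ∀ (φ : Hist Δ n) (v : Vec m), driverD V φ (f φ v) ≤ ((-α' (V φ) + γ ‖v‖ : ℝ) : EReal) := by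
  obtain ⟨h0, -, _, α₂, -, h2, hb⟩ := hV
  obtain ⟨κ, hκ, -, hκ2⟩ := h2.exists_inverse
  refine ⟨α ∘ κ, hα.comp hκ, fun φ v => (h φ v).trans (EReal.coe_le_coe_iff.2 ?_)⟩
  have h3 : κ (V φ) ≤ ‖φ‖ := (hκ.1.mono (h0 φ) (hb φ).2).trans_eq (hκ2 _ (norm_nonneg _))
  have := hα.1.mono (hκ.1.nonneg (h0 φ)) h3
  simp only [Function.comp_apply]
  linarith

theorem IsLKF.exists_driverD_le_of_gain (hV : IsLKF V) (hα : ClassKinf α) (hγ : ClassN γ)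
    (h : ∀ (φ : Hist Δ n) (v : Vec m),
      driverD V φ (f φ v) ≤ ((-α (V φ) + γ ‖v‖ : ℝ) : EReal)) :
    ∃ α' χ : ℝ → ℝ, ClassP α' ∧ ClassN χ ∧ ∀ (φ : Hist Δ n) (v : Vec m), χ ‖v‖ ≤ V φ →
      driverD V φ (f φ v) ≤ ((-α' ‖ev0 φ‖ : ℝ) : EReal) := by
  obtain ⟨h0, -, α₁, _, h1, -, hb⟩ := hV
  obtain ⟨κ, hκ, hκ1, -⟩ := hα.exists_inverse
  have hγ2 : ClassN fun s => 2 * γ s :=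
    ⟨continuousOn_const.mul hγ.1, fun s hs t ht hst =>
      mul_le_mul_of_nonneg_left (hγ.2.1 hs ht hst) zero_le_two, by simp [hγ.2.2]⟩
  have hαα := (hα.comp h1).1
  refine ⟨fun s => (α ∘ α₁) s / 2, κ ∘ fun s => 2 * γ s, ⟨hαα.1.div_const 2,
    by simp [h1.1.2.2, hα.1.2.2], fun s hs => half_pos (hαα.pos hs)⟩, hκ.1.classN.comp hγ2,
    fun φ v hv => (h φ v).trans (EReal.coe_le_coe_iff.2 ?_)⟩
  have h3 := hα.1.mono ((hκ.1.classN.comp hγ2).nonneg (norm_nonneg v)) hv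
  simp only [Function.comp_apply] at h3 ⊢
  rw [hκ1 _ (hγ2.nonneg (norm_nonneg v))] at h3
  have h4 := hα.1.mono (h1.1.nonneg (norm_nonneg _)) (hb φ).1
  linarith

end LKFImplications

section Regularity
variable {Δ : ℝ≥0} {n m : ℕ} {f : Hist Δ n → Vec m → Vec n} {u : ℝ → Vec m} {φ : Hist Δ n}
  {tm : EReal} {x : ℝ → Vec n} {T : ℝ} {V : Hist Δ n → ℝ}

theorem IsSolution.exists_rhs_bound (hf : LipOnBounded f) (hx : IsSolution Δ f u φ tm x)
    (hu : IsInput u) (hT : (T : EReal) < tm) :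
    ∃ M : ℝ, 0 < M ∧ ∀ᵐ s : ℝ, s ∈ Icc 0 T → ‖f (seg Δ x s) (u s)‖ ≤ M := by
  obtain ⟨C, hC⟩ := hx.exists_bound hT
  obtain ⟨D, hD⟩ := hu.exists_bound T
  obtain ⟨M, hM, h⟩ := hf.exists_bound (max C D)
  refine ⟨M, hM, ?_⟩
  filter_upwards [hD] with s hs hsT
  exact h _ _ ((hC s hsT).trans (le_max_left _ _)) ((hs hsT).trans (le_max_right _ _))

theorem IsSolution.norm_sub_le (hx : IsSolution Δ f u φ tm x) (hT : (T : EReal) < tm) {M : ℝ}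
    (hM : ∀ᵐ s : ℝ, s ∈ Icc 0 T → ‖f (seg Δ x s) (u s)‖ ≤ M) {s t : ℝ} (hs : 0 ≤ s)
    (hst : s ≤ t) (ht : t ≤ T) : ‖x t - x s‖ ≤ M * (t - s) := by
  have h0t := hs.trans hst
  rw [hx.integral_eq t h0t (IsSolution.lt_of_mem hT ht),
    hx.integral_eq s hs (IsSolution.lt_of_mem hT (hst.trans ht)), add_sub_add_left_eq_sub,
    intervalIntegral.integral_interval_sub_left
      (hx.integrable t h0t (IsSolution.lt_of_mem hT ht))
      (hx.integrable s hs (IsSolution.lt_of_mem hT (hst.trans ht))),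
    ← abs_of_nonneg (sub_nonneg.2 hst)]
  refine intervalIntegral.norm_integral_le_of_norm_le_const_ae ?_
  filter_upwards [hM] with r hr hrs
  rw [uIoc_of_le hst] at hrs
  exact hr ⟨hs.trans hrs.1.le, hrs.2.trans ht⟩

theorem IsSolution.ae_hasDerivAt (hx : IsSolution Δ f u φ tm x) (hT : (T : EReal) < tm)
    (h0 : 0 ≤ T) :
    ∀ᵐ s : ℝ, s ∈ Ioo 0 T → HasDerivAt x (f (seg Δ x s) (u s)) s := by
  filter_upwards [(hx.integrable T h0 hT).ae_hasDerivAt_integral] with s hs hsT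
  have h1 := hs (by rw [uIcc_of_le h0]; exact Ioo_subset_Icc_self hsT) 0 left_mem_uIcc
  refine (h1.const_add (x 0)).congr_of_eventuallyEq ?_
  filter_upwards [Ioo_mem_nhds hsT.1 hsT.2] with r hr
  exact hx.integral_eq r hr.1.le (IsSolution.lt_of_mem hT hr.2.le)

/-- Lipschitz initial histories. -/
def IsLipHist (φ : Hist Δ n) : Prop :=
  ∃ K : ℝ, 0 ≤ K ∧ ∀ τ τ' : Icc (-(Δ : ℝ)) (0 : ℝ), ‖φ τ - φ τ'‖ ≤ K * |τ.1 - τ'.1|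

theorem IsSolution.exists_lipschitz (hf : LipOnBounded f) (hx : IsSolution Δ f u φ tm x)
    (hu : IsInput u) (hT : (T : EReal) < tm) (hφ : IsLipHist φ) :
    ∃ K : ℝ, 0 ≤ K ∧ ∀ s ∈ Icc (-(Δ : ℝ)) T, ∀ t ∈ Icc (-(Δ : ℝ)) T, s ≤ t →
      ‖x t - x s‖ ≤ K * (t - s) := by
  obtain ⟨M, hM, hMb⟩ := hx.exists_rhs_bound hf hu hT
  obtain ⟨K, hK, hKb⟩ := hφ
  have hneg : ∀ s t : ℝ, -(Δ : ℝ) ≤ s → s ≤ t → t ≤ 0 → ‖x t - x s‖ ≤ K * (t - s) := by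
    intro s t hs hst ht
    rw [hx.init ⟨s, hs, hst.trans ht⟩, hx.init ⟨t, hs.trans hst, ht⟩]
    refine (hKb _ _).trans_eq ?_
    rw [abs_of_nonneg (sub_nonneg.2 hst)]
  refine ⟨K + M, by positivity, fun s hs t ht hst => ?_⟩
  have hst' := sub_nonneg.2 hst
  rcases le_total t 0 with ht0 | ht0
  · exact (hneg s t hs.1 hst ht0).trans
      (mul_le_mul_of_nonneg_right (by linarith) hst')
  rcases le_total 0 s with hs0 | hs0
  · exact (hx.norm_sub_le hT hMb hs0 hst ht.2).trans
      (mul_le_mul_of_nonneg_right (by linarith) hst')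
  · have h1 := hneg s 0 hs.1 hs0 le_rfl
    have h2 := hx.norm_sub_le hT hMb le_rfl ht0 ht.2
    have h3 := norm_sub_le_norm_sub_add_norm_sub (x t) (x 0) (x s)
    nlinarith

theorem IsSolution.exists_lipschitzOnWith (hf : LipOnBounded f) (hx : IsSolution Δ f u φ tm x)
    (hu : IsInput u) (hT : (T : EReal) < tm) (hφ : IsLipHist φ) (hV : LipOnBoundedV V) :
    ∃ K : ℝ≥0, LipschitzOnWith K (fun t => V (seg Δ x t)) (Icc 0 T) := by
  obtain ⟨K, hK, hKb⟩ := hx.exists_lipschitz hf hu hT hφ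
  obtain ⟨C, hC⟩ := hx.exists_bound hT
  obtain ⟨L, hL, hLb⟩ := hV (|C| + 1) (by positivity)
  have hC' : ∀ t ∈ Icc (0 : ℝ) T, ‖seg Δ x t‖ ≤ |C| + 1 := fun t ht =>
    (hC t ht).trans (by linarith [le_abs_self C])
  have hsym : ∀ s ∈ Icc (-(Δ : ℝ)) T, ∀ t ∈ Icc (-(Δ : ℝ)) T, ‖x s - x t‖ ≤ K * |s - t| := by
    intro s hs t ht
    rcases le_total s t with h | h
    · rw [norm_sub_rev, abs_sub_comm, abs_of_nonneg (sub_nonneg.2 h)]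
      exact hKb s hs t ht h
    · rw [abs_of_nonneg (sub_nonneg.2 h)]
      exact hKb t ht s hs h
  have hw : ∀ t ∈ Icc (0 : ℝ) T, ContinuousOn x (Icc (t - Δ) t) := fun t ht =>
    hx.continuousOn_window (IsSolution.lt_of_mem hT ht.2) ht.1
  have hmem : ∀ t ∈ Icc (0 : ℝ) T, ∀ τ ∈ Icc (-(Δ : ℝ)) 0, t + τ ∈ Icc (-(Δ : ℝ)) T :=
    fun t ht τ hτ => ⟨by linarith [ht.1, hτ.1], by linarith [ht.2, hτ.2]⟩
  refine ⟨NNReal.mk (L * K) (by positivity), LipschitzOnWith.of_dist_le_mul fun s hs t ht => ?_⟩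
  rw [Real.dist_eq, Real.dist_eq, NNReal.coe_mk, mul_assoc]
  refine (hLb _ _ (hC' s hs) (hC' t ht)).trans (mul_le_mul_of_nonneg_left ?_ hL.le)
  refine _root_.norm_seg_sub_le (by positivity) (hw s hs) (hw t ht) fun τ hτ => ?_
  simpa using hsym _ (hmem s hs τ hτ) _ (hmem t ht τ hτ)

/-- Lipschitz histories are dense. -/
theorem exists_isLipHist_norm_sub_le (φ : Hist Δ n) {ε : ℝ} (hε : 0 < ε) :
    ∃ ψ : Hist Δ n, IsLipHist ψ ∧ ‖φ - ψ‖ ≤ ε := by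
  have hΔ : -(Δ : ℝ) ≤ 0 := neg_nonpos.2 Δ.coe_nonneg
  let g : ℝ → Vec n := IccExtend hΔ φ
  have hg : Continuous g := φ.continuous.Icc_extend'
  have hgb : ∀ s, ‖g s‖ ≤ ‖φ‖ := fun s => φ.norm_coe_le_norm _
  have hi : ∀ a b, IntervalIntegrable g volume a b := fun a b => hg.intervalIntegrable a b
  have hgφ : ∀ τ : Icc (-(Δ : ℝ)) (0 : ℝ), g τ.1 = φ τ := fun τ => IccExtend_val hΔ φ τ
  have huc : UniformContinuous g :=
    (CompactSpace.uniformContinuous_of_continuous φ.continuous).comp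
      (LipschitzWith.projIcc hΔ).uniformContinuous
  obtain ⟨δ, hδ, hδb⟩ := Metric.uniformContinuous_iff.1 huc ε hε
  set h : ℝ := δ / 2 with hh
  have h0 : 0 < h := by positivity
  let P : ℝ → Vec n := fun s => ∫ r in (0 : ℝ)..s, g r
  have hPc : Continuous P := intervalIntegral.continuous_primitive hi 0
  have hPsub : ∀ a b, P b - P a = ∫ r in a..b, g r := fun a b =>
    intervalIntegral.integral_interval_sub_left (hi _ _) (hi _ _)
  have hPL : ∀ a b, ‖P b - P a‖ ≤ ‖φ‖ * |b - a| := fun a b => by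
    rw [hPsub]
    exact intervalIntegral.norm_integral_le_of_norm_le_const fun r _ => hgb r
  let ψ : Hist Δ n := ⟨fun τ => h⁻¹ • (P (τ.1 + h) - P τ.1), by fun_prop⟩
  refine ⟨ψ, ⟨h⁻¹ * (2 * ‖φ‖), by positivity, fun τ τ' => ?_⟩, ?_⟩
  · change ‖h⁻¹ • (P (τ.1 + h) - P τ.1) - h⁻¹ • (P (τ'.1 + h) - P τ'.1)‖ ≤ _
    rw [← smul_sub, norm_smul, Real.norm_of_nonneg (by positivity), mul_assoc]
    refine mul_le_mul_of_nonneg_left ?_ (by positivity)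
    have h1 := hPL (τ'.1 + h) (τ.1 + h)
    have h2 := hPL τ'.1 τ.1
    rw [add_sub_add_right_eq_sub] at h1
    rw [sub_sub_sub_comm]
    refine (_root_.norm_sub_le _ _).trans ?_
    linarith
  · rw [ContinuousMap.norm_le _ hε.le]
    intro τ
    have h1 : φ τ = h⁻¹ • ∫ _ in τ.1..(τ.1 + h), g τ.1 := by
      rw [intervalIntegral.integral_const, add_sub_cancel_left, smul_smul,
        inv_mul_cancel₀ h0.ne', one_smul, hgφ]
    change ‖φ τ - h⁻¹ • (P (τ.1 + h) - P τ.1)‖ ≤ ε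
    rw [h1, hPsub, ← smul_sub, ← intervalIntegral.integral_sub intervalIntegrable_const (hi _ _),
      norm_smul, Real.norm_of_nonneg (by positivity), inv_mul_le_iff₀ h0]
    have h2 : ∀ r ∈ uIoc τ.1 (τ.1 + h), ‖g τ.1 - g r‖ ≤ ε := fun r hr => by
      rw [uIoc_of_le (by linarith)] at hr
      rw [← dist_eq_norm]
      refine (hδb ?_).le
      rw [Real.dist_eq, abs_sub_lt_iff]
      constructor <;> linarith [hr.1, hr.2]
    refine (intervalIntegral.norm_integral_le_of_norm_le_const h2).trans_eq ?_
    rw [add_sub_cancel_left, abs_of_pos h0, mul_comm]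

end Regularity

/-- A Lyapunov–Krasovskii functional with pointwise dissipation in implication form, together
with the comparison functions involved. -/
structure IsPointwiseISSLKF {Δ : ℝ≥0} {n m : ℕ} (f : Hist Δ n → Vec m → Vec n)
    (V : Hist Δ n → ℝ) (α₁ α₂ α χ : ℝ → ℝ) : Prop where
  lip_rhs : LipOnBounded f
  nonneg : ∀ φ, 0 ≤ V φ
  lip : LipOnBoundedV V
  lower_classKinf : ClassKinf α₁
  upper_classKinf : ClassKinf α₂
  lower : ∀ φ, α₁ ‖ev0 φ‖ ≤ V φ
  upper : ∀ φ, V φ ≤ α₂ ‖φ‖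
  rate : ClassP α
  gain : ClassN χ
  le_gain : ∀ s, 0 ≤ s → s ≤ χ s
  driverD_le : ∀ (φ : Hist Δ n) (v : Vec m), χ ‖v‖ ≤ V φ →
    driverD V φ (f φ v) ≤ ((-α ‖ev0 φ‖ : ℝ) : EReal)

namespace IsPointwiseISSLKF
variable {Δ : ℝ≥0} {n m : ℕ} {f : Hist Δ n → Vec m → Vec n} {V : Hist Δ n → ℝ}
  {α₁ α₂ α χ : ℝ → ℝ} {u : ℝ → Vec m} {φ : Hist Δ n} {tm : EReal} {x : ℝ → Vec n} {s t T : ℝ}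

theorem rate_nonneg (h : IsPointwiseISSLKF f V α₁ α₂ α χ) {s : ℝ} (hs : 0 ≤ s) : 0 ≤ α s := by
  rcases hs.eq_or_lt with rfl | hs
  · exact h.rate.2.1.ge
  · exact (h.rate.2.2 s hs).le

theorem le_sub_mul (h : IsPointwiseISSLKF f V α₁ α₂ α χ) (hu : IsInput u)
    (hx : IsSolution Δ f u φ tm x) (hφ : IsLipHist φ) (hT : (T : EReal) < tm) (hs : 0 ≤ s)
    (hst : s ≤ t) (ht : t ≤ T) (hχ : ∀ r ∈ Ioo s t, χ (essBnd u (Icc 0 T)) ≤ V (seg Δ x r))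
    {a : ℝ} (ha : ∀ r ∈ Ioo s t, a ≤ α ‖x r‖) :
    V (seg Δ x t) ≤ V (seg Δ x s) - a * (t - s) := by
  obtain ⟨K, hK⟩ := hx.exists_lipschitzOnWith h.lip_rhs hu hT hφ h.lip
  refine LipschitzOnWith.le_sub_mul_of_ae_dini hst (hK.mono (Icc_subset_Icc hs ht)) ?_
  filter_upwards [hx.ae_hasDerivAt hT (hs.trans (hst.trans ht)), hu.ae_norm_le_essBnd T]
    with r h1 h2 hr ε hε
  have hr0 : 0 < r := hs.trans_lt hr.1
  have hrT : r < T := hr.2.trans_le ht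
  have hgain : χ ‖u r‖ ≤ V (seg Δ x r) :=
    (h.gain.mono (norm_nonneg _) (h2 ⟨hr0.le, hrT.le⟩)).trans (hχ r hr)
  have hdr := h.driverD_le (seg Δ x r) (u r) hgain
  rw [ev0_seg (hx.continuousOn_window (IsSolution.lt_of_mem hT hrT.le) hr0.le)] at hdr
  refine eventually_le_of_driverD_le h.lip (sub_pos.2 hrT) ?_ (h1 ⟨hr0, hrT⟩).hasDerivWithinAt
    (hdr.trans (EReal.coe_le_coe_iff.2 (neg_le_neg (ha r hr)))) hε
  exact (hx.continuousOn_Icc hT).mono (Icc_subset_Icc (by linarith) (by linarith))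

theorem le_max (h : IsPointwiseISSLKF f V α₁ α₂ α χ) (hu : IsInput u)
    (hx : IsSolution Δ f u φ tm x) (hφ : IsLipHist φ) (hT : (T : EReal) < tm) (hs : 0 ≤ s)
    (hst : s ≤ t) (ht : t ≤ T) :
    V (seg Δ x t) ≤ max (V (seg Δ x s)) (χ (essBnd u (Icc 0 T))) := by
  set c := max (V (seg Δ x s)) (χ (essBnd u (Icc 0 T))) with hc
  by_contra! hlt
  obtain ⟨K, hK⟩ := hx.exists_lipschitzOnWith h.lip_rhs hu hT hφ h.lip
  have hcont : ContinuousOn (fun r => V (seg Δ x r)) (Icc s t) :=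
    hK.continuousOn.mono (Icc_subset_Icc hs ht)
  let S : Set ℝ := Icc s t ∩ (fun r => V (seg Δ x r)) ⁻¹' Iic c
  have hS : IsCompact S :=
    isCompact_Icc.of_isClosed_subset
      (hcont.preimage_isClosed_of_isClosed isClosed_Icc isClosed_Iic) inter_subset_left
  obtain ⟨r, ⟨hr, hrc⟩, hmax⟩ := hS.exists_isGreatest ⟨s, ⟨le_rfl, hst⟩,
    mem_preimage.2 (mem_Iic.2 (le_max_left _ _))⟩
  have hgt : ∀ q ∈ Ioo r t, c < V (seg Δ x q) := fun q hq => by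
    by_contra! hle
    exact (hmax ⟨⟨hr.1.trans hq.1.le, hq.2.le⟩, hle⟩).not_gt hq.1
  have := h.le_sub_mul hu hx hφ hT (hs.trans hr.1) hr.2 ht (a := 0)
    (fun q hq => (le_max_right _ _).trans (hgt q hq).le) fun q _ => h.rate_nonneg (norm_nonneg _)
  have hrc' : V (seg Δ x r) ≤ c := hrc
  linarith

theorem lower_norm_le (h : IsPointwiseISSLKF f V α₁ α₂ α χ) (hx : IsSolution Δ f u φ tm x)
    (ht : (t : EReal) < tm) (h0 : 0 ≤ t) : α₁ ‖x t‖ ≤ V (seg Δ x t) := by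
  have := h.lower (seg Δ x t)
  rwa [ev0_seg (hx.continuousOn_window ht h0)] at this

theorem lower_norm_le_max (h : IsPointwiseISSLKF f V α₁ α₂ α χ) (hu : IsInput u)
    (hx : IsSolution Δ f u φ tm x) (hφ : IsLipHist φ) (hT : (T : EReal) < tm) (h0 : 0 ≤ t)
    (ht : t ≤ T) : α₁ ‖x t‖ ≤ max (α₂ ‖φ‖) (χ (essBnd u (Icc 0 T))) := by
  refine (h.lower_norm_le hx (IsSolution.lt_of_mem hT ht) h0).trans
    ((h.le_max hu hx hφ hT le_rfl h0 ht).trans (max_le_max ?_ le_rfl))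
  rw [hx.seg_zero]
  exact h.upper φ

theorem eq_top (h : IsPointwiseISSLKF f V α₁ α₂ α χ) (hu : IsInput u)
    (hx : IsMaxSolution Δ f u φ tm x) (hφ : IsLipHist φ) : tm = ⊤ := by
  by_contra htop
  have hpos := hx.1.tmax_pos
  lift tm to ℝ using ⟨htop, (bot_lt_of_lt hpos).ne'⟩
  obtain ⟨κ, hκ, -, hκ2⟩ := h.lower_classKinf.exists_inverse
  refine EReal.coe_ne_top tm (hx.eq_top_of_bounded h.lip_rhs hu
    (B := κ (max (α₂ ‖φ‖) (χ (essBnd u (Icc 0 tm))))) fun t h0 ht => ?_)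
  rw [← hκ2 ‖x t‖ (norm_nonneg _)]
  refine hκ.1.mono (h.lower_classKinf.1.nonneg (norm_nonneg _))
    ((h.lower_norm_le_max hu hx.1 hφ ht h0 le_rfl).trans (max_le_max le_rfl ?_))
  exact h.gain.mono (essBnd_nonneg _ _) (hu.essBnd_mono (EReal.coe_lt_coe_iff.1 ht).le)

/-- Uniform attraction time for Lipschitz initial histories. -/
theorem exists_attraction_time (h : IsPointwiseISSLKF f V α₁ α₂ α χ) {r ε : ℝ} (hr : 0 < r)
    (hε : 0 < ε) :
    ∃ T₀ : ℝ, ∀ (u : ℝ → Vec m) (φ : Hist Δ n) (x : ℝ → Vec n), IsInput u →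
      IsSolution Δ f u φ ⊤ x → IsLipHist φ → ‖φ‖ ≤ r → ∀ t, 0 ≤ t → T₀ ≤ t →
        V (seg Δ x t) ≤ max ε (χ (essBnd u (Icc 0 t))) := by
  obtain ⟨κ₁, hκ₁, -, hκ₁'⟩ := h.lower_classKinf.exists_inverse
  obtain ⟨κ₂, hκ₂, -, hκ₂'⟩ := h.upper_classKinf.exists_inverse
  have hΔ := Δ.coe_nonneg
  set A := α₂ r with hA
  have hA0 : 0 < A := h.upper_classKinf.1.pos hr
  have hκA := hκ₁.1.nonneg hA0.le
  set B := κ₁ A + r with hB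
  have hB0 : 0 < B := by positivity
  obtain ⟨M, hM, hMb⟩ := h.lip_rhs.exists_bound (B + A)
  set δ := κ₂ ε with hδ
  have hδ0 : 0 < δ := hκ₂.1.pos hε
  set η := δ / (4 * M) with hη
  have hη0 : 0 < η := by positivity
  have hMη : M * η = δ / 4 := by rw [hη]; field_simp
  obtain ⟨a, ha, hab⟩ : ∃ a : ℝ, 0 < a ∧ ∀ s ∈ Icc (δ / 2) (B + δ), a ≤ α s := by
    obtain ⟨s₀, hs₀, hmin⟩ := isCompact_Icc.exists_isMinOn
      (nonempty_Icc.2 (by linarith : δ / 2 ≤ B + δ))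
      (h.rate.1.mono fun s hs => mem_Ici.2 (by linarith [hs.1]))
    exact ⟨α s₀, h.rate.2.2 s₀ (by linarith [hs₀.1]), fun s hs => hmin hs⟩
  set k := ⌊A / (a * η)⌋₊ + 1 with hk
  refine ⟨k * (Δ + η), fun u φ x hu hx hφ hφr t h0 ht => ?_⟩
  by_contra! hlt
  set U := essBnd u (Icc 0 t) with hU
  have hlt1 := (le_max_left _ _).trans_lt hlt
  have hlt2 := (le_max_right _ _).trans_lt hlt
  have hT : (t : EReal) < ⊤ := EReal.coe_lt_top t
  have hbig : ∀ s, 0 ≤ s → s ≤ t → max ε (χ U) < V (seg Δ x s) := fun s hs hst => by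
    have := hlt.trans_le (h.le_max hu hx hφ hT hs hst le_rfl)
    rcases lt_max_iff.1 this with h1 | h1
    · exact h1
    · exact absurd h1 (le_max_right _ _).not_gt
  have hv0 : V (seg Δ x 0) ≤ A := by
    rw [hx.seg_zero]
    exact (h.upper φ).trans (h.upper_classKinf.1.mono (norm_nonneg _) hφr)
  have hχA : χ U < A := ((le_max_right _ _).trans_lt (hbig 0 le_rfl h0)).trans_le hv0
  have hUA : U ≤ A := (h.le_gain U (essBnd_nonneg _ _)).trans hχA.le
  have hxB : ∀ s, 0 ≤ s → s ≤ t → ‖x s‖ ≤ B := fun s hs hst => by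
    have h1 : α₁ ‖x s‖ ≤ A := (h.lower_norm_le hx (EReal.coe_lt_top s) hs).trans
      ((h.le_max hu hx hφ hT le_rfl hs hst).trans (max_le hv0 hχA.le))
    have h2 := hκ₁.1.mono (h.lower_classKinf.1.nonneg (norm_nonneg _)) h1
    rw [hκ₁' _ (norm_nonneg _)] at h2
    linarith
  have hsegB : ∀ s, 0 ≤ s → s ≤ t → ‖seg Δ x s‖ ≤ B := fun s hs hst =>
    hx.norm_seg_le (by linarith) (fun q hq hqs => hxB q hq (hqs.trans hst)) hs
  have hrhs : ∀ᵐ s : ℝ, s ∈ Icc 0 t → ‖f (seg Δ x s) (u s)‖ ≤ M := by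
    filter_upwards [hu.ae_norm_le_essBnd t] with s hs hst
    exact hMb _ _ ((hsegB s hst.1 hst.2).trans (by linarith)) ((hs hst).trans (by linarith))
  have hanti : ∀ s q, 0 ≤ s → s ≤ q → q ≤ t → V (seg Δ x q) ≤ V (seg Δ x s) := by
    intro s q hs hsq hqt
    rcases le_max_iff.1 (h.le_max hu hx hφ hT hs hsq hqt) with h1 | h1
    · exact h1
    · exact absurd ((le_max_right _ _).trans_lt (hbig q (hs.trans hsq) hqt)) h1.not_gt
  have hstep : ∀ s, 0 ≤ s → s + (Δ + η) ≤ t →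
      V (seg Δ x (s + (Δ + η))) ≤ V (seg Δ x s) - a * η := by
    intro s hs hst
    have hδseg : δ ≤ ‖seg Δ x (s + Δ)‖ := by
      have h1 := ((le_max_left _ _).trans (hbig (s + Δ) (by positivity) (by linarith)).le).trans
        (h.upper (seg Δ x (s + Δ)))
      have h2 := hκ₂.1.mono hε.le h1
      rwa [hκ₂' _ (norm_nonneg _)] at h2
    obtain ⟨q, hq, hxq⟩ : ∃ q ∈ Icc s (s + Δ), 3 * δ / 4 < ‖x q‖ := by
      by_contra! hno
      have := norm_seg_le (Δ := Δ) (x := x) (t := s + Δ) (by positivity : 0 ≤ 3 * δ / 4)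
        fun q hq => hno q ⟨by linarith [hq.1], hq.2⟩
      linarith
    have hq0 : 0 ≤ q := hs.trans hq.1
    have hqt : q + η ≤ t := by linarith [hq.2]
    have h1 : V (seg Δ x (q + η)) ≤ V (seg Δ x q) - a * (q + η - q) := by
      refine h.le_sub_mul hu hx hφ hT hq0 (by linarith) hqt
        (fun p hp => (le_max_right _ _).trans (hbig p (hq0.trans hp.1.le)
          (hp.2.le.trans hqt)).le) fun p hp => hab _ ⟨?_, ?_⟩
      · have h2 := hx.norm_sub_le hT hrhs hq0 hp.1.le (hp.2.le.trans hqt)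
        have h3 : M * (p - q) ≤ M * η := mul_le_mul_of_nonneg_left (by linarith [hp.2]) hM.le
        have h4 := norm_sub_norm_le (x q) (x p)
        rw [norm_sub_rev] at h4
        linarith
      · linarith [hxB p (hq0.trans hp.1.le) (hp.2.le.trans hqt)]
    have h2 := hanti s q hs hq.1 (by linarith)
    have h3 := hanti (q + η) (s + (Δ + η)) (by linarith) (by linarith [hq.2]) hst
    rw [add_sub_cancel_left] at h1
    linarith
  have hind : ∀ j : ℕ, j * (Δ + η) ≤ t → V (seg Δ x (j * (Δ + η))) ≤ A - j * (a * η) := by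
    intro j
    induction j with
    | zero => intro _; simpa using hv0
    | succ j ih =>
      intro hj
      push_cast at hj ⊢
      rw [add_mul, one_mul] at hj ⊢
      have h1 := ih (by linarith)
      have h2 := hstep (j * (Δ + η)) (by positivity) hj
      linarith
  have hfin := hind k ht
  have haη : 0 < a * η := by positivity
  have hlt3 : A < k * (a * η) := by
    rw [← div_lt_iff₀ haη, hk]
    push_cast
    exact Nat.lt_floor_add_one _
  linarith [h.nonneg (seg Δ x (k * (Δ + η)))]

theorem exists_estimate_of_isLipHist (h : IsPointwiseISSLKF f V α₁ α₂ α χ) :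
    ∃ β μ, ClassKL β ∧ ClassN μ ∧ ∀ (u : ℝ → Vec m) (φ : Hist Δ n) (x : ℝ → Vec n), IsInput u →
      IsSolution Δ f u φ ⊤ x → IsLipHist φ → ∀ t, 0 ≤ t →
        ‖x t‖ ≤ β ‖φ‖ t + μ (essBnd u (Icc 0 t)) := by
  obtain ⟨κ, hκ, hκ1, hκ2⟩ := h.lower_classKinf.exists_inverse
  choose! T₀ hT₀ using fun r ε => h.exists_attraction_time (r := r) (ε := ε)
  obtain ⟨β, hβ, hβb⟩ := exists_classKL_of_attraction (hκ.comp h.upper_classKinf).1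
    fun r ε => T₀ (|r| + 1) (α₁ ε)
  refine ⟨β, κ ∘ χ, hβ, hκ.1.classN.comp h.gain, fun u φ x hu hx hφ t ht => ?_⟩
  have hβ0 : 0 ≤ β ‖φ‖ t := (hβ.1 t ht).nonneg (norm_nonneg φ)
  have hμ0 := (hκ.1.classN.comp h.gain).nonneg (essBnd_nonneg u (Icc 0 t))
  rcases le_or_gt ‖x t‖ ((κ ∘ χ) (essBnd u (Icc 0 t))) with hle | hlt
  · linarith
  have hα := h.lower_norm_le hx (EReal.coe_lt_top t) ht
  have hinv : ∀ c, 0 ≤ c → α₁ ‖x t‖ ≤ c → ‖x t‖ ≤ κ c := fun c _ hle => by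
    have := hκ.1.mono (h.lower_classKinf.1.nonneg (norm_nonneg _)) hle
    rwa [hκ2 _ (norm_nonneg _)] at this
  have hχ0 := h.gain.nonneg (essBnd_nonneg u (Icc 0 t))
  have hnot : ¬ α₁ ‖x t‖ ≤ χ (essBnd u (Icc 0 t)) := fun hle =>
    (hinv _ hχ0 hle).not_gt hlt
  suffices ‖x t‖ ≤ β ‖φ‖ t by linarith
  refine hβb _ _ _ (norm_nonneg _) ht (norm_nonneg _) ?_ fun r ε hr hε hT => ?_
  · refine hinv _ (h.upper_classKinf.1.nonneg (norm_nonneg _)) ?_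
    exact (le_max_iff.1 (h.lower_norm_le_max hu hx hφ (EReal.coe_lt_top t) ht le_rfl)).resolve_right
      hnot
  · have h1 := hα.trans (hT₀ (|r| + 1) (α₁ ε) (by positivity) (h.lower_classKinf.1.pos hε) u φ x hu
      hx hφ (hr.trans (by linarith [le_abs_self r])) t ht hT)
    have h2 := hinv _ (h.lower_classKinf.1.nonneg hε.le) ((le_max_iff.1 h1).resolve_right hnot)
    rwa [hκ2 _ hε.le] at h2

theorem iss (h : IsPointwiseISSLKF f V α₁ α₂ α χ) : ISS Δ f := by
  obtain ⟨β, μ, hβ, hμ, hest⟩ := h.exists_estimate_of_isLipHist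
  refine ⟨β, μ, hβ, hμ, fun φ u tm x hu hx => ?_⟩
  have hmain : ∀ t : ℝ, 0 ≤ t → (t : EReal) < tm →
      ‖x t‖ ≤ β ‖φ‖ t + μ (essBnd u (Icc 0 t)) := by
    intro t ht htm
    choose ψ hψ hψφ using fun j : ℕ =>
      exists_isLipHist_norm_sub_le φ (Nat.one_div_pos_of_nat (α := ℝ) (n := j))
    choose τ y hy using fun j => exists_isMaxSolution h.lip_rhs hu (ψ j)
    have hyt : ∀ j, IsSolution Δ f u (ψ j) ⊤ (y j) := fun j => by
      have := (hy j).1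
      rwa [h.eq_top hu (hy j) (hψ j)] at this
    have hψlim : Tendsto (fun j => ‖φ - ψ j‖) atTop (𝓝 0) :=
      squeeze_zero (fun _ => norm_nonneg _) hψφ tendsto_one_div_add_atTop_nhds_zero_nat
    have hψnorm : Tendsto (fun j => ‖ψ j‖) atTop (𝓝 ‖φ‖) := by
      have : Tendsto ψ atTop (𝓝 φ) := by
        rw [tendsto_iff_norm_sub_tendsto_zero]
        simpa [norm_sub_rev] using hψlim
      exact this.norm
    have hψ1 : ∀ j, ‖ψ j‖ ≤ ‖φ‖ + 1 := fun j => by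
      have h1 := norm_le_insert' (ψ j) φ
      have h2 := hψφ j
      have h3 : (1 : ℝ) / (j + 1) ≤ 1 := by
        rw [div_le_one (by positivity)]; linarith [(Nat.cast_nonneg j : (0 : ℝ) ≤ j)]
      rw [norm_sub_rev] at h2
      linarith
    set U := essBnd u (Icc 0 t) with hU
    have hU0 : 0 ≤ U := essBnd_nonneg _ _
    obtain ⟨C, hC⟩ := hx.1.exists_bound htm
    set R := |C| + (‖φ‖ + 1) + β (‖φ‖ + 1) 0 + μ U + U with hR
    have hβ0 : 0 ≤ β (‖φ‖ + 1) 0 := (hβ.1 0 le_rfl).nonneg (by positivity)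
    have hμ0 : 0 ≤ μ U := hμ.nonneg hU0
    have hR0 : 0 < R := by positivity
    have hseg : ∀ j, ∀ s ∈ Icc (0 : ℝ) t, ‖seg Δ (y j) s‖ ≤ R := fun j s hs => by
      refine (hyt j).norm_seg_le ((hψ1 j).trans (by linarith [abs_nonneg C]))
        (fun q hq hqs => (hest u _ _ hu (hyt j) (hψ j) q hq).trans ?_) hs.1
      have h1 : β ‖ψ j‖ q ≤ β (‖φ‖ + 1) 0 :=
        ((hβ.2 _ (norm_nonneg _)).2.1 self_mem_Ici (mem_Ici.2 hq) hq).trans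
          ((hβ.1 0 le_rfl).mono (norm_nonneg _) (hψ1 j))
      have h2 : μ (essBnd u (Icc 0 q)) ≤ μ U :=
        hμ.mono (essBnd_nonneg _ _) (hu.essBnd_mono (hqs.trans hs.2))
      linarith [abs_nonneg C, norm_nonneg φ]
    obtain ⟨L, hL, hLb⟩ := h.lip_rhs R hR0
    have hdist : ∀ j, ‖x t‖ ≤ β ‖ψ j‖ t + μ U + ‖φ - ψ j‖ * Real.exp (L * t) := fun j => by
      have h1 := hx.1.norm_seg_sub_le (hyt j) htm (EReal.coe_lt_top t)
        (Eventually.of_forall fun _ _ => rfl) hL hLb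
        (fun s hs => (hC s hs).trans (by linarith [le_abs_self C, norm_nonneg φ])) (hseg j) (by
          filter_upwards [hu.ae_norm_le_essBnd t] with s hs hst
          exact (hs hst).trans (by linarith [abs_nonneg C, norm_nonneg φ])) t ⟨ht, le_rfl⟩
      have h2 := norm_sub_le_norm_seg_sub (hx.1.continuousOn_window htm ht)
        ((hyt j).continuousOn_window (EReal.coe_lt_top t) ht)
        (⟨by linarith [Δ.coe_nonneg], le_rfl⟩ : t ∈ Icc (t - (Δ : ℝ)) t)
      have h3 := norm_le_insert' (x t) (y j t)
      linarith [hest u _ _ hu (hyt j) (hψ j) t ht]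
    have hβlim : Tendsto (fun j => β ‖ψ j‖ t) atTop (𝓝 (β ‖φ‖ t)) :=
      ((hβ.1 t ht).1 ‖φ‖ (norm_nonneg φ)).tendsto.comp
        (tendsto_nhdsWithin_iff.2 ⟨hψnorm, Eventually.of_forall fun _ => norm_nonneg _⟩)
    have hlim := (hβlim.add_const (μ U)).add (hψlim.mul_const (Real.exp (L * t)))
    rw [zero_mul, add_zero] at hlim
    exact ge_of_tendsto' hlim hdist
  have htop : tm = ⊤ := by
    by_contra htop
    have hpos := hx.1.tmax_pos
    lift tm to ℝ using ⟨htop, (bot_lt_of_lt hpos).ne'⟩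
    refine EReal.coe_ne_top tm (hx.eq_top_of_bounded h.lip_rhs hu
      (B := β ‖φ‖ 0 + μ (essBnd u (Icc 0 tm))) fun t h0 ht => (hmain t h0 ht).trans ?_)
    exact add_le_add ((hβ.2 _ (norm_nonneg _)).2.1 self_mem_Ici (mem_Ici.2 h0) h0)
      (hμ.mono (essBnd_nonneg _ _) (hu.essBnd_mono (EReal.coe_lt_coe_iff.1 ht).le))
  exact ⟨htop, fun t ht => hmain t ht (htop ▸ EReal.coe_lt_top t)⟩

end IsPointwiseISSLKF

section ConverseLyapunov

variable {X D : Type*} [NormedAddCommGroup X]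

/-- A family of controlled semiflows with controls in `D` for which the origin is an equilibrium
that attracts bounded sets uniformly in the control. -/
structure IsUniformlyAttractedFlow (S : ℝ → X → D → X) : Prop where
  zero_time : ∀ φ d, S 0 φ d = φ
  concat : ∀ φ d d' h, 0 ≤ h → ∃ d'', ∀ t, 0 ≤ t → S (t + h) φ d'' = S t (S h φ d) d'
  equilibrium : ∀ t d, 0 ≤ t → S t 0 d = 0
  attraction : ∀ r ε : ℝ, 0 < r → 0 < ε → ∃ T : ℝ, 0 ≤ T ∧
    ∀ φ d t, ‖φ‖ ≤ r → T ≤ t → ‖S t φ d‖ ≤ ε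
  lipschitz : ∀ r T : ℝ, 0 < r → 0 ≤ T → ∃ L : ℝ, 0 < L ∧ ∀ φ ψ d t, ‖φ‖ ≤ r → ‖ψ‖ ≤ r →
    0 ≤ t → t ≤ T → ‖S t φ d - S t ψ d‖ ≤ L * ‖φ - ψ‖

/-- The exponentially weighted excess over `ε` of a trajectory, at a given time and control. -/
noncomputable def weightedExcess (S : ℝ → X → D → X) (ε : ℝ) (φ : X) (p : Ici (0 : ℝ) × D) : ℝ :=
  Real.exp p.1 * max 0 (‖S p.1 φ p.2‖ - ε)

/-- The largest exponentially weighted excess over `ε` among all trajectories. -/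
noncomputable def supExcess (S : ℝ → X → D → X) (ε : ℝ) (φ : X) : ℝ :=
  ⨆ p, weightedExcess S ε φ p

namespace IsUniformlyAttractedFlow

variable {S : ℝ → X → D → X} {ε r : ℝ}

theorem weightedExcess_nonneg (φ : X) (p : Ici (0 : ℝ) × D) : 0 ≤ weightedExcess S ε φ p :=
  mul_nonneg (Real.exp_pos _).le (le_max_left _ _)

theorem weightedExcess_zero (hS : IsUniformlyAttractedFlow S) (hε : 0 < ε)
    (p : Ici (0 : ℝ) × D) : weightedExcess S ε 0 p = 0 := by
  simp [weightedExcess, hS.equilibrium p.1 p.2 p.1.2, hε.le]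

theorem exists_weightedExcess_le (hS : IsUniformlyAttractedFlow S) (hε : 0 < ε) (hr : 0 < r) :
    ∃ K : ℝ, 0 < K ∧ ∀ φ ψ p, ‖φ‖ ≤ r → ‖ψ‖ ≤ r →
      weightedExcess S ε φ p ≤ weightedExcess S ε ψ p + K * ‖φ - ψ‖ := by
  obtain ⟨T, hT, hT'⟩ := hS.attraction r ε hr hε
  obtain ⟨L, hL, hL'⟩ := hS.lipschitz r T hr hT
  refine ⟨Real.exp T * L, by positivity, fun φ ψ p hφ hψ => ?_⟩
  rcases le_total T p.1 with h | h
  · have h0 : weightedExcess S ε φ p = 0 := by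
      simp [weightedExcess, hT' φ p.2 p.1 hφ h]
    rw [h0]
    have := weightedExcess_nonneg (S := S) (ε := ε) ψ p
    positivity
  · have h1 := hL' φ ψ p.2 p.1 hφ hψ p.1.2 h
    have h2 := norm_sub_norm_le (S p.1 φ p.2) (S p.1 ψ p.2)
    have h3 : max 0 (‖S p.1 φ p.2‖ - ε) ≤ max 0 (‖S p.1 ψ p.2‖ - ε) + L * ‖φ - ψ‖ := by
      refine max_le (by positivity) ?_
      linarith [le_max_right 0 (‖S p.1 ψ p.2‖ - ε)]
    have h4 : Real.exp p.1 * (L * ‖φ - ψ‖) ≤ Real.exp T * (L * ‖φ - ψ‖) := by gcongr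
    have h5 := mul_le_mul_of_nonneg_left h3 (Real.exp_pos (p.1 : ℝ)).le
    unfold weightedExcess
    linarith

theorem bddAbove_weightedExcess (hS : IsUniformlyAttractedFlow S) (hε : 0 < ε) (φ : X) :
    BddAbove (range (weightedExcess S ε φ)) := by
  obtain ⟨K, -, hK⟩ := hS.exists_weightedExcess_le hε (by positivity : 0 < ‖φ‖ + 1)
  refine ⟨K * ‖φ‖, ?_⟩
  rintro _ ⟨p, rfl⟩
  have := hK φ 0 p (by linarith) (by rw [norm_zero]; positivity)
  rwa [hS.weightedExcess_zero hε, zero_add, sub_zero] at this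

theorem supExcess_nonneg (φ : X) : 0 ≤ supExcess S ε φ :=
  Real.iSup_nonneg fun p => weightedExcess_nonneg φ p

theorem supExcess_zero (hS : IsUniformlyAttractedFlow S) (hε : 0 < ε) : supExcess S ε 0 = 0 := by
  simp [supExcess, hS.weightedExcess_zero hε]

theorem exists_abs_supExcess_sub_le [Nonempty D] (hS : IsUniformlyAttractedFlow S) (hε : 0 < ε)
    (hr : 0 < r) : ∃ K : ℝ, 0 < K ∧ ∀ φ ψ, ‖φ‖ ≤ r → ‖ψ‖ ≤ r →
      |supExcess S ε φ - supExcess S ε ψ| ≤ K * ‖φ - ψ‖ := by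
  obtain ⟨K, hK0, hK⟩ := hS.exists_weightedExcess_le hε hr
  have key : ∀ φ ψ, ‖φ‖ ≤ r → ‖ψ‖ ≤ r →
      supExcess S ε φ ≤ supExcess S ε ψ + K * ‖φ - ψ‖ := fun φ ψ hφ hψ =>
    ciSup_le fun p => (hK φ ψ p hφ hψ).trans
      (by gcongr; exact le_ciSup (hS.bddAbove_weightedExcess hε ψ) p)
  refine ⟨K, hK0, fun φ ψ hφ hψ => abs_sub_le_iff.2 ⟨?_, ?_⟩⟩
  · linarith [key φ ψ hφ hψ]
  · have := key ψ φ hψ hφ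
    rw [norm_sub_rev] at this
    linarith

theorem le_supExcess [Nonempty D] (hS : IsUniformlyAttractedFlow S) (hε : 0 < ε) (φ : X) :
    max 0 (‖φ‖ - ε) ≤ supExcess S ε φ := by
  obtain ⟨d⟩ := ‹Nonempty D›
  refine le_trans ?_ (le_ciSup (hS.bddAbove_weightedExcess hε φ) (⟨0, self_mem_Ici⟩, d))
  simp [weightedExcess, hS.zero_time]

theorem supExcess_le (hS : IsUniformlyAttractedFlow S) (hε : 0 < ε) (φ : X) (d : D) {h : ℝ}
    (hh : 0 ≤ h) : supExcess S ε (S h φ d) ≤ Real.exp (-h) * supExcess S ε φ := by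
  have : Nonempty D := ⟨d⟩
  refine ciSup_le fun p => ?_
  obtain ⟨d'', hd⟩ := hS.concat φ d p.2 h hh
  have h1 := le_ciSup (hS.bddAbove_weightedExcess hε φ) (⟨p.1 + h, add_nonneg p.1.2 hh⟩, d'')
  have h2 : weightedExcess S ε (S h φ d) p =
      Real.exp (-h) * weightedExcess S ε φ (⟨p.1 + h, add_nonneg p.1.2 hh⟩, d'') := by
    simp only [weightedExcess, hd p.1 p.1.2]
    rw [← mul_assoc, ← Real.exp_add]
    congr 2
    ring
  rw [h2]
  exact mul_le_mul_of_nonneg_left h1 (Real.exp_pos _).le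

end IsUniformlyAttractedFlow

theorem classKinf_tsum_mul_max {a : ℕ → ℝ} (ha : ∀ q, 0 < a q) (hsum : Summable a) :
    ClassKinf fun s => ∑' q : ℕ, a q * max 0 (s - 1 / (q + 1)) := by
  have hq : ∀ q : ℕ, (0 : ℝ) < 1 / (q + 1) := fun q => Nat.one_div_pos_of_nat
  have hle : ∀ s t : ℝ, ∀ q : ℕ, max 0 (s - 1 / (q + 1)) ≤ max 0 (t - 1 / (q + 1)) + |s - t| :=
    fun s t q => max_le (by positivity)
      (by linarith [le_max_right 0 (t - 1 / ((q : ℝ) + 1)), le_abs_self (s - t)])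
  have hsm : ∀ s : ℝ, Summable fun q : ℕ => a q * max 0 (s - 1 / (q + 1)) := fun s => by
    refine Summable.of_nonneg_of_le (fun q => mul_nonneg (ha q).le (le_max_left _ _))
      (fun q => ?_) (hsum.mul_right |s|)
    refine mul_le_mul_of_nonneg_left ?_ (ha q).le
    exact max_le (abs_nonneg s) (by linarith [hq q, le_abs_self s])
  have hmono : ∀ s t : ℝ, s ≤ t → ∀ q : ℕ,
      a q * max 0 (s - 1 / (q + 1)) ≤ a q * max 0 (t - 1 / (q + 1)) := fun s t hst q =>
    mul_le_mul_of_nonneg_left (max_le_max le_rfl (by linarith)) (ha q).le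
  refine ⟨⟨?_, ?_, ?_⟩, ?_⟩
  · refine Continuous.continuousOn (LipschitzWith.continuous (K := (∑' q, a q).toNNReal)
      (LipschitzWith.of_le_add_mul _ fun s t => ?_))
    rw [Real.coe_toNNReal _ (tsum_nonneg fun q => (ha q).le), ← tsum_mul_right,
      ← (hsm t).tsum_add (hsum.mul_right _)]
    refine (hsm s).tsum_le_tsum (fun q => ?_) ((hsm t).add (hsum.mul_right _))
    rw [← mul_add, Real.dist_eq]
    exact mul_le_mul_of_nonneg_left (hle s t q) (ha q).le
  · intro s hs t ht hst
    obtain ⟨q, hqt⟩ := exists_nat_one_div_lt (lt_of_le_of_lt hs hst)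
    refine (hsm s).tsum_lt_tsum (hmono s t hst.le) (i := q) ?_ (hsm t)
    refine mul_lt_mul_of_pos_left ?_ (ha q)
    rw [max_eq_right (b := t - _) (by linarith)]
    exact max_lt (by linarith) (by linarith)
  · simp [(fun q => by simpa using (hq q).le : ∀ q : ℕ, (0 : ℝ) ≤ ((q : ℝ) + 1)⁻¹)]
  · refine tendsto_atTop_mono (f := fun s => a 0 * (s - 1)) (fun s => ?_)
      ((tendsto_atTop_add_const_right _ (-1) tendsto_id).const_mul_atTop (ha 0))
    refine le_trans ?_ ((hsm s).le_tsum 0 fun q _ => mul_nonneg (ha q).le (le_max_left _ _))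
    refine mul_le_mul_of_nonneg_left ?_ (ha 0).le
    simp

/-- Converse Lyapunov theorem with an exponentially decaying functional. -/
theorem IsUniformlyAttractedFlow.exists_lyapunov [Nonempty D] {S : ℝ → X → D → X}
    (hS : IsUniformlyAttractedFlow S) :
    ∃ V : X → ℝ, (∀ φ, 0 ≤ V φ) ∧
      (∀ r : ℝ, 0 < r → ∃ L : ℝ, 0 < L ∧ ∀ φ ψ, ‖φ‖ ≤ r → ‖ψ‖ ≤ r →
        |V φ - V ψ| ≤ L * ‖φ - ψ‖) ∧
      (∃ α₁ α₂, ClassKinf α₁ ∧ ClassKinf α₂ ∧ ∀ φ, α₁ ‖φ‖ ≤ V φ ∧ V φ ≤ α₂ ‖φ‖) ∧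
      ∀ φ d h, 0 ≤ h → V (S h φ d) ≤ Real.exp (-h) * V φ := by
  have hε : ∀ q : ℕ, (0 : ℝ) < 1 / (q + 1) := fun q => Nat.one_div_pos_of_nat
  set U : ℕ → X → ℝ := fun q => supExcess S (1 / (q + 1)) with hU
  have hU0 : ∀ q φ, 0 ≤ U q φ := fun q φ => supExcess_nonneg φ
  choose Λ hΛmono hΛpos hΛ using fun q : ℕ => exists_monotone_bound
    (P := fun r K => ∀ φ ψ, ‖φ‖ ≤ r → ‖ψ‖ ≤ r → |U q φ - U q ψ| ≤ K * ‖φ - ψ‖)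
    (fun r hr => hS.exists_abs_supExcess_sub_le (hε q) hr)
    (fun r L L' h hL φ ψ hφ hψ => (h φ ψ hφ hψ).trans (by gcongr))
    (fun r r' L h hr φ ψ hφ hψ => h φ ψ (hφ.trans hr) (hψ.trans hr))
  set a : ℕ → ℝ := fun q => (1 / 2) ^ q / (1 + Λ q q) with ha
  have ha0 : ∀ q, 0 < a q := fun q => by have := hΛpos q q; positivity
  have haΛ : ∀ q, a q * (1 + Λ q q) = (1 / 2) ^ q := fun q => by
    have := hΛpos q q
    simp only [ha]
    field_simp
  have hgeo : Summable fun q : ℕ => ((1 : ℝ) / 2) ^ q := summable_geometric_two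
  have hsa : Summable a := Summable.of_nonneg_of_le (fun q => (ha0 q).le) (fun q => by
    rw [← haΛ q]
    have := mul_pos (ha0 q) (hΛpos q q)
    linarith) hgeo
  have hsΛ : ∀ r, Summable fun q => a q * Λ q r := fun r => by
    refine Summable.of_norm_bounded_eventually_nat hgeo ?_
    filter_upwards [eventually_ge_atTop ⌈r⌉₊] with q hq
    rw [Real.norm_of_nonneg (mul_pos (ha0 q) (hΛpos q r)).le, ← haΛ q]
    refine mul_le_mul_of_nonneg_left ?_ (ha0 q).le
    linarith [hΛmono q (Nat.ceil_le.1 hq)]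
  have hUle : ∀ q φ, U q φ ≤ Λ q ‖φ‖ * ‖φ‖ := fun q φ => by
    have := hΛ q ‖φ‖ φ 0 le_rfl (by simp)
    rw [hU] at this
    simp only [hS.supExcess_zero (hε q), sub_zero] at this
    exact (le_abs_self _).trans this
  have hsU : ∀ φ, Summable fun q => a q * U q φ := fun φ =>
    Summable.of_nonneg_of_le (fun q => mul_nonneg (ha0 q).le (hU0 q φ))
      (fun q => by rw [mul_assoc]; exact mul_le_mul_of_nonneg_left (hUle q φ) (ha0 q).le)
      ((hsΛ ‖φ‖).mul_right ‖φ‖)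
  have hle : ∀ r φ ψ, ‖φ‖ ≤ r → ‖ψ‖ ≤ r →
      ∑' q, a q * U q φ ≤ ∑' q, a q * U q ψ + (∑' q, a q * Λ q r) * ‖φ - ψ‖ := by
    intro r φ ψ hφ hψ
    rw [← tsum_mul_right, ← (hsU ψ).tsum_add ((hsΛ r).mul_right _)]
    refine (hsU φ).tsum_le_tsum (fun q => ?_) ((hsU ψ).add ((hsΛ r).mul_right _))
    rw [mul_assoc, ← mul_add]
    refine mul_le_mul_of_nonneg_left ?_ (ha0 q).le
    linarith [(abs_le.1 (hΛ q r φ ψ hφ hψ)).2]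
  have hlip : ∀ r : ℝ, 0 < r → ∃ L : ℝ, 0 < L ∧ ∀ φ ψ, ‖φ‖ ≤ r → ‖ψ‖ ≤ r →
      |∑' q, a q * U q φ - ∑' q, a q * U q ψ| ≤ L * ‖φ - ψ‖ := fun r _ => by
    refine ⟨∑' q, a q * Λ q r, (hsΛ r).tsum_pos (fun q => (mul_pos (ha0 q) (hΛpos q r)).le) 0
      (mul_pos (ha0 0) (hΛpos 0 r)), fun φ ψ hφ hψ => abs_sub_le_iff.2 ⟨?_, ?_⟩⟩
    · linarith [hle r φ ψ hφ hψ]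
    · have := hle r ψ φ hψ hφ
      rw [norm_sub_rev] at this
      linarith
  refine ⟨fun φ => ∑' q, a q * U q φ, fun φ => tsum_nonneg fun q => mul_nonneg (ha0 q).le
    (hU0 q φ), hlip, ?_, fun φ d h hh => ?_⟩
  · obtain ⟨κ, hκ, hκle⟩ := exists_classKinf_mul_le (g := fun r => ∑' q, a q * Λ q r)
      (fun r r' hr => (hsΛ r).tsum_le_tsum
        (fun q => mul_le_mul_of_nonneg_left (hΛmono q hr) (ha0 q).le) (hsΛ r'))
      fun r => tsum_nonneg fun q => (mul_pos (ha0 q) (hΛpos q r)).le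
    refine ⟨_, κ, classKinf_tsum_mul_max ha0 hsa, hκ, fun φ => ⟨?_, ?_⟩⟩
    · refine Summable.tsum_le_tsum (fun q => mul_le_mul_of_nonneg_left
        (hS.le_supExcess (hε q) φ) (ha0 q).le) ?_ (hsU φ)
      exact Summable.of_nonneg_of_le (fun q => mul_nonneg (ha0 q).le (le_max_left _ _))
        (fun q => mul_le_mul_of_nonneg_left (hS.le_supExcess (hε q) φ) (ha0 q).le) (hsU φ)
    · have h0 := hle ‖φ‖ φ 0 le_rfl (by simp)
      have h1 : ∀ q, U q 0 = 0 := fun q => hS.supExcess_zero (hε q)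
      simp only [h1, mul_zero, tsum_zero, zero_add, sub_zero] at h0
      exact h0.trans (hκle _ (norm_nonneg _))
  · rw [← tsum_mul_left]
    refine (hsU _).tsum_le_tsum (fun q => ?_) ((hsU φ).mul_left _)
    have := mul_le_mul_of_nonneg_left (hS.supExcess_le (hε q) φ d hh) (ha0 q).le
    linarith

end ConverseLyapunov

section Gain

/-- A Lipschitz minorant of a class `𝒦∞` function that is still unbounded. -/
theorem ClassKinf.exists_lipschitz_minorant {σ : ℝ → ℝ} (hσ : ClassKinf σ) :
    ∃ ρ : ℝ → ℝ, LipschitzWith 1 ρ ∧ (∀ s, 0 ≤ ρ s) ∧ (∀ s, 0 ≤ s → ρ s ≤ σ s) ∧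
      Tendsto ρ atTop atTop := by
  have hpos : ∀ (s : ℝ) (t : Ici (0 : ℝ)), 0 ≤ σ t + |s - t| := fun s t =>
    add_nonneg (hσ.1.nonneg t.2) (abs_nonneg _)
  have hbdd : ∀ s : ℝ, BddBelow (range fun t : Ici (0 : ℝ) => σ t + |s - t|) := fun s =>
    ⟨0, by rintro _ ⟨t, rfl⟩; exact hpos s t⟩
  refine ⟨fun s => ⨅ t : Ici (0 : ℝ), (σ t + |s - t|), LipschitzWith.of_le_add fun s s' => ?_,
    fun s => le_ciInf (hpos s), fun s hs => ?_, ?_⟩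
  · rw [← sub_le_iff_le_add]
    refine le_ciInf fun t => ?_
    have h1 := ciInf_le (hbdd s) t
    have h2 := abs_sub_le s s' t
    rw [Real.dist_eq]
    linarith
  · simpa using ciInf_le (hbdd s) ⟨s, hs⟩
  · have hhalf : Tendsto (fun s : ℝ => s / 2) atTop atTop := tendsto_id.atTop_div_const two_pos
    refine tendsto_atTop.2 fun b => ?_
    filter_upwards [(tendsto_atTop.1 (hσ.2.comp hhalf)) b, (tendsto_atTop.1 hhalf) b,
      eventually_ge_atTop 0] with s hs hs' hs0
    refine le_ciInf fun t => ?_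
    rcases le_total (s / 2) t with h | h
    · have := hσ.1.mono (by positivity) h
      simp only [Function.comp_apply] at hs
      linarith [abs_nonneg (s - t)]
    · linarith [le_abs_self (s - t), hσ.1.nonneg t.2]

end Gain

section ClosedLoop

variable {Δ : ℝ≥0} {n m : ℕ} {f : Hist Δ n → Vec m → Vec n} {ρ σ μ : ℝ → ℝ} {β : ℝ → ℝ → ℝ}
  {d : ℝ → Vec m} {φ : Hist Δ n} {tm : EReal} {x : ℝ → Vec n} {t M r : ℝ}

/-- The closed loop obtained by feeding back disturbances scaled by a state-dependent margin. -/
noncomputable def closedLoop (f : Hist Δ n → Vec m → Vec n) (ρ : ℝ → ℝ) :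
    Hist Δ n → Vec m → Vec n :=
  fun φ d => f φ (ρ ‖φ‖ • d)

theorem LipOnBounded.closedLoop (hf : LipOnBounded f) (hρ : LipschitzWith 1 ρ) :
    LipOnBounded (closedLoop f ρ) := by
  intro r hr
  set B := |ρ 0| + r with hB
  have hB0 : 0 < B := by positivity
  have hρB : ∀ φ : Hist Δ n, ‖φ‖ ≤ r → |ρ ‖φ‖| ≤ B := fun φ hφ => by
    have h1 := hρ.dist_le_mul ‖φ‖ 0
    rw [Real.dist_eq, Real.dist_eq, sub_zero, abs_norm, NNReal.coe_one, one_mul] at h1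
    have h2 := abs_sub_abs_le_abs_sub (ρ ‖φ‖) (ρ 0)
    linarith
  have hle : ∀ (φ : Hist Δ n) (v : Vec m), ‖φ‖ ≤ r → ‖v‖ ≤ r → ‖ρ ‖φ‖ • v‖ ≤ r + B * r :=
    fun φ v hφ hv => by
      rw [norm_smul, Real.norm_eq_abs]
      have := mul_le_mul (hρB φ hφ) hv (norm_nonneg _) hB0.le
      linarith
  obtain ⟨L, hL, hL'⟩ := hf (r + B * r) (by positivity)
  refine ⟨L * (1 + r + B), by positivity, fun φ₁ φ₂ v₁ v₂ h₁ h₂ hv₁ hv₂ => ?_⟩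
  have hrB : r ≤ r + B * r := by linarith [mul_pos hB0 hr]
  refine (hL' φ₁ φ₂ _ _ (h₁.trans hrB) (h₂.trans hrB) (hle _ _ h₁ hv₁) (hle _ _ h₂ hv₂)).trans ?_
  rw [mul_assoc]
  refine mul_le_mul_of_nonneg_left ?_ hL.le
  have hsplit : ρ ‖φ₁‖ • v₁ - ρ ‖φ₂‖ • v₂ =
      (ρ ‖φ₁‖ - ρ ‖φ₂‖) • v₁ + ρ ‖φ₂‖ • (v₁ - v₂) := by
    rw [sub_smul, smul_sub]; abel
  have h3 : |ρ ‖φ₁‖ - ρ ‖φ₂‖| ≤ ‖φ₁ - φ₂‖ := by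
    have := hρ.dist_le_mul ‖φ₁‖ ‖φ₂‖
    rw [Real.dist_eq, Real.dist_eq, NNReal.coe_one, one_mul] at this
    exact this.trans (abs_norm_sub_norm_le _ _)
  have h4 : ‖ρ ‖φ₁‖ • v₁ - ρ ‖φ₂‖ • v₂‖ ≤ ‖φ₁ - φ₂‖ * r + B * ‖v₁ - v₂‖ := by
    rw [hsplit]
    refine (norm_add_le _ _).trans (add_le_add ?_ ?_)
    · rw [norm_smul, Real.norm_eq_abs]
      exact mul_le_mul h3 hv₁ (norm_nonneg _) (norm_nonneg _)
    · rw [norm_smul, Real.norm_eq_abs]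
      exact mul_le_mul_of_nonneg_right (hρB φ₂ h₂) (norm_nonneg _)
  have h5 : 0 ≤ B * ‖φ₁ - φ₂‖ := by positivity
  have h6 : 0 ≤ (1 + r) * ‖v₁ - v₂‖ := by positivity
  linarith

/-- Measurable disturbances with values in the closed unit ball. -/
def IsDisturbance (d : ℝ → Vec m) : Prop :=
  Measurable d ∧ ∀ t, ‖d t‖ ≤ 1

theorem IsDisturbance.isInput (hd : IsDisturbance d) : IsInput d :=
  ⟨hd.1, fun _ _ => ⟨1, .of_forall fun t _ => hd.2 t⟩⟩

/-- Data of an ISS system together with a feedback margin `ρ` that its input gain tolerates. -/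
structure IsISSMargin (f : Hist Δ n → Vec m → Vec n) (β : ℝ → ℝ → ℝ) (μ σ ρ : ℝ → ℝ) : Prop where
  lip_rhs : LipOnBounded f
  decay : ClassKL β
  gain : ClassN μ
  estimate : ∀ (x₀ : Hist Δ n) (u : ℝ → Vec m) (tmax : EReal) (x : ℝ → Vec n),
    IsInput u → IsMaxSolution Δ f u x₀ tmax x →
      tmax = ⊤ ∧ ∀ t : ℝ, 0 ≤ t → ‖x t‖ ≤ β ‖x₀‖ t + μ (essBnd u (Icc 0 t))
  bound : ClassKinf σ
  gain_bound : ∀ s, 0 ≤ s → μ (σ s) ≤ s / 4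
  lip : LipschitzWith 1 ρ
  nonneg : ∀ s, 0 ≤ ρ s
  le_bound : ∀ s, 0 ≤ s → ρ s ≤ σ s
  unbounded : Tendsto ρ atTop atTop

theorem ISS.exists_isISSMargin (hf : LipOnBounded f) (h : ISS Δ f) :
    ∃ (β : ℝ → ℝ → ℝ) (μ σ ρ : ℝ → ℝ), IsISSMargin f β μ σ ρ := by
  obtain ⟨β, μ, hβ, hμ, hest⟩ := h
  have hμ4 : ClassN fun s => 4 * μ s :=
    ⟨continuousOn_const.mul hμ.1, fun s hs t ht hst => by
      have := hμ.2.1 hs ht hst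
      simp only
      linarith, by simp [hμ.2.2]⟩
  obtain ⟨σ, hσ, hinv, -⟩ := hμ4.add_id.exists_inverse
  obtain ⟨ρ, hρ, hρ0, hρσ, hρt⟩ := hσ.exists_lipschitz_minorant
  refine ⟨β, μ, σ, ρ, hf, hβ, hμ, hest, hσ, fun s hs => ?_, hρ, hρ0, hρσ, hρt⟩
  have h1 := hinv s hs
  have h2 := hσ.1.nonneg hs
  linarith

namespace IsISSMargin

theorem norm_le (h : IsISSMargin f β μ σ ρ) (hd : IsDisturbance d)
    (hx : IsSolution Δ (closedLoop f ρ) d φ tm x) (ht : (t : EReal) < tm)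
    (hM : ∀ s ∈ Icc (0 : ℝ) t, ‖seg Δ x s‖ ≤ M) :
    ∀ s ∈ Icc (0 : ℝ) t, ‖x s‖ ≤ β ‖φ‖ s + M / 4 := by
  intro s hs
  have ht0 : 0 ≤ t := hs.1.trans hs.2
  have hM0 : 0 ≤ M := (norm_nonneg _).trans (hM s hs)
  obtain ⟨y, hy, hyx⟩ := exists_continuous_extension
    (by linarith [Δ.coe_nonneg] : -(Δ : ℝ) ≤ t) (hx.continuousOn_Icc ht)
  have hseg : ∀ s ∈ Icc (0 : ℝ) t, seg Δ y s = seg Δ x s := fun s hs =>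
    seg_congr (hyx.mono (Icc_subset_Icc (by linarith [hs.1]) hs.2))
  set u : ℝ → Vec m := (Icc 0 t).indicator fun s => ρ ‖seg Δ y s‖ • d s with hu
  have hueq : ∀ s ∈ Icc (0 : ℝ) t, u s = ρ ‖seg Δ x s‖ • d s := fun s hs => by
    rw [hu, indicator_of_mem hs, hseg s hs]
  have hσ0 : 0 ≤ σ M := h.bound.1.nonneg hM0
  have hule : ∀ s, ‖u s‖ ≤ σ M := fun s => by
    by_cases hs : s ∈ Icc 0 t
    · rw [hueq s hs, norm_smul, Real.norm_of_nonneg (h.nonneg _)]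
      calc ρ ‖seg Δ x s‖ * ‖d s‖ ≤ ρ ‖seg Δ x s‖ * 1 :=
            mul_le_mul_of_nonneg_left (hd.2 s) (h.nonneg _)
        _ ≤ σ ‖seg Δ x s‖ := by rw [mul_one]; exact h.le_bound _ (norm_nonneg _)
        _ ≤ σ M := h.bound.1.mono (norm_nonneg _) (hM s hs)
    · rw [hu, indicator_of_notMem hs, norm_zero]
      exact hσ0
  have huI : IsInput u := by
    refine ⟨Measurable.indicator ?_ measurableSet_Icc,
      fun T _ => ⟨σ M, .of_forall fun s _ => hule s⟩⟩
    exact (h.lip.continuous.comp (continuous_seg hy).norm).measurable.smul hd.1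
  obtain ⟨tm', z, hz⟩ := exists_isMaxSolution h.lip_rhs huI φ
  obtain ⟨rfl, hzb⟩ := h.estimate φ u tm' z huI hz
  have heq := hx.eqOn hz.1 ht (EReal.coe_lt_top t) h.lip_rhs
    (.of_forall fun s hs => by rw [hueq s hs]; rfl) ⟨σ M, .of_forall fun s _ => hule s⟩
  rw [heq ⟨by linarith [hs.1, Δ.coe_nonneg], hs.2⟩]
  refine (hzb s hs.1).trans (add_le_add le_rfl ?_)
  exact (h.gain.mono (essBnd_nonneg _ _)
    (essBnd_le hσ0 (.of_forall fun s _ => hule s))).trans (h.gain_bound M hM0)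

theorem norm_seg_le (h : IsISSMargin f β μ σ ρ) (hd : IsDisturbance d)
    (hx : IsSolution Δ (closedLoop f ρ) d φ tm x) (ht : (t : EReal) < tm) (ht0 : 0 ≤ t) :
    ‖seg Δ x t‖ ≤ 2 * (‖φ‖ + β ‖φ‖ 0) := by
  obtain ⟨s, hs, hmax⟩ := isCompact_Icc.exists_isMaxOn (nonempty_Icc.2 ht0)
    (hx.continuousOn_seg ht).norm
  have hM : ∀ r ∈ Icc (0 : ℝ) t, ‖seg Δ x r‖ ≤ ‖seg Δ x s‖ := fun r hr => hmax hr
  have hβ0 := (h.decay.1 0 le_rfl).nonneg (norm_nonneg φ)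
  have h1 := hx.norm_seg_le (B := ‖φ‖ + β ‖φ‖ 0 + ‖seg Δ x s‖ / 4) (t := s)
    (by linarith [norm_nonneg (seg Δ x s)])
    (fun r hr hrs => by
      have h2 := h.norm_le hd hx ht hM r ⟨hr, hrs.trans hs.2⟩
      have h3 := (h.decay.2 ‖φ‖ (norm_nonneg _)).2.1 self_mem_Ici hr hr
      linarith [norm_nonneg φ]) hs.1
  linarith [hM t ⟨ht0, le_rfl⟩, norm_nonneg φ]

theorem exists_solution (h : IsISSMargin f β μ σ ρ) (hd : IsDisturbance d) (φ : Hist Δ n) :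
    ∃ x, IsSolution Δ (closedLoop f ρ) d φ ⊤ x := by
  have hcl := h.lip_rhs.closedLoop h.lip
  obtain ⟨tm, x, hx⟩ := exists_isMaxSolution hcl hd.isInput φ
  have := hx.eq_top_of_bounded hcl hd.isInput fun t ht htm => by
    have h1 := h.norm_seg_le hd hx.1 htm ht
    have h2 := norm_le_norm_seg (hx.1.continuousOn_window htm ht)
      (right_mem_Icc.2 (by linarith [Δ.coe_nonneg]))
    exact h2.trans h1
  exact ⟨x, this ▸ hx.1⟩

theorem mono_norm_bound (h : IsISSMargin f β μ σ ρ) {s : ℝ} (hs : 0 ≤ s) (hsr : s ≤ r) :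
    2 * (s + β s 0) ≤ 2 * (r + β r 0) := by
  have : β s 0 ≤ β r 0 := (h.decay.1 0 le_rfl).mono hs hsr
  linarith

theorem exists_halving_time (h : IsISSMargin f β μ σ ρ) (hr : 0 < r) (k : ℕ) :
    ∃ T : ℝ, 0 ≤ T ∧ ∀ (d : ℝ → Vec m) (φ : Hist Δ n) (x : ℝ → Vec n), IsDisturbance d →
      IsSolution Δ (closedLoop f ρ) d φ ⊤ x → ‖φ‖ ≤ r → ∀ t, T ≤ t →
        ‖seg Δ x t‖ ≤ 2 * (r + β r 0) / 2 ^ k := by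
  have hβ0 : 0 ≤ β r 0 := (h.decay.1 0 le_rfl).nonneg hr.le
  induction k with
  | zero =>
    refine ⟨0, le_rfl, fun d φ x hd hx hφ t ht => ?_⟩
    rw [pow_zero, div_one]
    exact (h.norm_seg_le hd hx (EReal.coe_lt_top t) ht).trans
      (h.mono_norm_bound (norm_nonneg _) hφ)
  | succ k ih =>
    obtain ⟨T, hT, hTb⟩ := ih
    set M := 2 * (r + β r 0) / 2 ^ k with hM
    have hM0 : 0 < M := by positivity
    obtain ⟨τ, hτ⟩ := ((((h.decay.2 M hM0.le).2.2).eventually_le_const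
      (by positivity : 0 < M / 4)).and (eventually_ge_atTop 0)).exists
    refine ⟨T + (τ + Δ), by have := hτ.2; positivity, fun d φ x hd hx hφ t ht => ?_⟩
    have hhalf : 2 * (r + β r 0) / 2 ^ (k + 1) = M / 2 := by
      rw [hM, pow_succ, div_div]
    rw [hhalf]
    have hshift := hx.shift hT
    have hd' : IsDisturbance fun s => d (s + T) :=
      ⟨hd.1.comp (measurable_id.add_const T), fun s => hd.2 _⟩
    refine _root_.norm_seg_le (by positivity) fun s hs => ?_
    have hs0 : τ ≤ s - T := by linarith [hs.1]
    have h1 := h.norm_le hd' hshift (EReal.coe_lt_top (s - T)) (M := M)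
      (fun q hq => by
        rw [seg_comp_add]
        exact hTb d φ x hd hx hφ _ (by linarith [hq.1])) (s - T)
      ⟨hτ.2.trans hs0, le_rfl⟩
    rw [sub_add_cancel] at h1
    have h2 : β ‖seg Δ x T‖ (s - T) ≤ β M (s - T) :=
      (h.decay.1 _ (hτ.2.trans hs0)).mono (norm_nonneg _) (hTb d φ x hd hx hφ T le_rfl)
    have h3 := (h.decay.2 M hM0.le).2.1 (mem_Ici.2 hτ.2) (mem_Ici.2 (hτ.2.trans hs0)) hs0
    linarith [hτ.1]

/-- The history segment at time `t` of the closed loop driven by a disturbance. -/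
noncomputable def flow (h : IsISSMargin f β μ σ ρ) (t : ℝ) (φ : Hist Δ n)
    (d : {d : ℝ → Vec m // IsDisturbance d}) : Hist Δ n :=
  seg Δ (h.exists_solution d.2 φ).choose t

theorem flow_eq (h : IsISSMargin f β μ σ ρ) (hd : IsDisturbance d)
    (hx : IsSolution Δ (closedLoop f ρ) d φ ⊤ x) (ht : 0 ≤ t) : h.flow t φ ⟨d, hd⟩ = seg Δ x t := by
  refine seg_congr (((h.exists_solution hd φ).choose_spec.eqOn hx (EReal.coe_lt_top t)
    (EReal.coe_lt_top t) (h.lip_rhs.closedLoop h.lip) (.of_forall fun s _ => rfl)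
    ⟨1, .of_forall fun s _ => hd.2 s⟩).mono (Icc_subset_Icc (by linarith) le_rfl))

theorem flow_concat (h : IsISSMargin f β μ σ ρ) (φ : Hist Δ n)
    (d d' : {d : ℝ → Vec m // IsDisturbance d}) (s : ℝ) (hs : 0 ≤ s) :
    ∃ d'', ∀ t, 0 ≤ t → h.flow (t + s) φ d'' = h.flow t (h.flow s φ d) d' := by
  classical
  set e : ℝ → Vec m := fun q => if q ≤ s then d.1 q else d'.1 (q - s) with he
  have hed : IsDisturbance e := by
    refine ⟨Measurable.ite measurableSet_Iic d.2.1
      (d'.2.1.comp (measurable_id.sub_const s)), fun q => ?_⟩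
    simp only [he]
    split_ifs
    exacts [d.2.2 _, d'.2.2 _]
  have hcl := h.lip_rhs.closedLoop h.lip
  obtain ⟨x, hx⟩ := h.exists_solution hed φ
  obtain ⟨y, hy⟩ := h.exists_solution d.2 φ
  obtain ⟨z, hz⟩ := h.exists_solution d'.2 (h.flow s φ d)
  refine ⟨⟨e, hed⟩, fun t ht => ?_⟩
  rw [h.flow_eq hed hx (add_nonneg ht hs), h.flow_eq d'.2 hz ht, ← seg_comp_add]
  have hxy : seg Δ x s = seg Δ y s := seg_congr ((hx.eqOn hy (EReal.coe_lt_top s)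
    (EReal.coe_lt_top s) hcl (.of_forall fun q hq => by simp only [he, if_pos hq.2])
    ⟨1, .of_forall fun q _ => d.2.2 q⟩).mono (Icc_subset_Icc (by linarith) le_rfl))
  have hshift := hx.shift hs
  rw [hxy, ← h.flow_eq d.2 hy hs] at hshift
  refine seg_congr ((hshift.eqOn hz (EReal.coe_lt_top t) (EReal.coe_lt_top t) hcl ?_
    ⟨1, .of_forall fun q _ => d'.2.2 q⟩).mono (Icc_subset_Icc (by linarith) le_rfl))
  filter_upwards [Measure.ae_ne volume (0 : ℝ)] with q hq0 hq
  have : ¬ q + s ≤ s := by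
    have := lt_of_le_of_ne hq.1 (Ne.symm hq0)
    linarith
  simp only [he, if_neg this, add_sub_cancel_right]

theorem isUniformlyAttractedFlow (h : IsISSMargin f β μ σ ρ) :
    IsUniformlyAttractedFlow h.flow where
  zero_time φ d := (h.exists_solution d.2 φ).choose_spec.seg_zero
  concat := h.flow_concat
  equilibrium t d ht := by
    have := h.norm_seg_le d.2 (h.exists_solution d.2 0).choose_spec (EReal.coe_lt_top t) ht
    have hβ : β 0 0 = 0 := (h.decay.1 0 le_rfl).2.2
    rw [norm_zero, hβ, add_zero, mul_zero] at this
    exact norm_le_zero_iff.1 this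
  attraction r ε hr hε := by
    obtain ⟨k, hk⟩ := exists_pow_lt_of_lt_one
      (div_pos hε (by have := (h.decay.1 0 le_rfl).nonneg hr.le; positivity :
        0 < 2 * (r + β r 0))) one_half_lt_one
    obtain ⟨T, hT, hT'⟩ := h.exists_halving_time hr k
    refine ⟨T, hT, fun φ d t hφ ht => (hT' d φ _ d.2
      (h.exists_solution d.2 φ).choose_spec hφ t ht).trans ?_⟩
    have h0 : 0 < 2 * (r + β r 0) := by
      have := (h.decay.1 0 le_rfl).nonneg hr.le
      positivity
    rw [lt_div_iff₀ h0] at hk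
    rw [div_eq_mul_inv, ← inv_pow, inv_eq_one_div, mul_comm]
    exact hk.le
  lipschitz r T hr hT := by
    have h0 : 0 ≤ β r 0 := (h.decay.1 0 le_rfl).nonneg hr.le
    obtain ⟨L, hL, hL'⟩ := h.lip_rhs.closedLoop h.lip (2 * (r + β r 0) + 1) (by positivity)
    refine ⟨Real.exp (L * T), Real.exp_pos _, fun φ ψ d t hφ hψ ht htT => ?_⟩
    have hb : ∀ χ : Hist Δ n, ‖χ‖ ≤ r → ∀ s ∈ Icc (0 : ℝ) T,
        ‖h.flow s χ d‖ ≤ 2 * (r + β r 0) + 1 := fun χ hχ s hs => by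
      have h1 := h.norm_seg_le d.2 (h.exists_solution d.2 χ).choose_spec
        (EReal.coe_lt_top s) hs.1
      have h2 := h.mono_norm_bound (norm_nonneg _) hχ
      exact h1.trans (by linarith)
    have := (h.exists_solution d.2 φ).choose_spec.norm_seg_sub_le
      (h.exists_solution d.2 ψ).choose_spec (EReal.coe_lt_top T) (EReal.coe_lt_top T)
      (.of_forall fun s _ => rfl) hL hL' (hb φ hφ) (hb ψ hψ)
      (.of_forall fun s _ => (d.2.2 s).trans (by linarith)) t ⟨ht, htT⟩
    refine this.trans ?_
    rw [mul_comm]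
    gcongr

end IsISSMargin

end ClosedLoop

section ConverseISS

variable {Δ : ℝ≥0} {n m : ℕ} {f : Hist Δ n → Vec m → Vec n} {ρ σ μ : ℝ → ℝ} {β : ℝ → ℝ → ℝ}
  {u : ℝ → Vec m} {φ : Hist Δ n} {tm : EReal} {x : ℝ → Vec n} {V : Hist Δ n → ℝ}

theorem IsSolution.hasDerivWithinAt_zero_of_const (hf : LipOnBounded f) {v : Vec m}
    (hx : IsSolution Δ f (fun _ => v) φ ⊤ x) : HasDerivWithinAt x (f φ v) (Ici 0) 0 := by
  obtain ⟨y, hy, hyx⟩ := exists_continuous_extension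
    (by linarith [Δ.coe_nonneg] : -(Δ : ℝ) ≤ 1) (hx.continuousOn_Icc (EReal.coe_lt_top 1))
  have hseg : ∀ s ∈ Icc (0 : ℝ) 1, seg Δ y s = seg Δ x s := fun s hs =>
    seg_congr (hyx.mono (Icc_subset_Icc (by linarith [hs.1]) hs.2))
  have hg : Continuous fun s => f (seg Δ y s) v :=
    hf.continuous.comp ((continuous_seg hy).prodMk continuous_const)
  have hd : HasDerivAt (fun t => x 0 + ∫ s in (0 : ℝ)..t, f (seg Δ y s) v)
      (f (seg Δ y 0) v) 0 :=
    (intervalIntegral.integral_hasDerivAt_right (hg.intervalIntegrable _ _)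
      (hg.stronglyMeasurableAtFilter _ _) hg.continuousAt).const_add _
  rw [hseg 0 ⟨le_rfl, zero_le_one⟩, hx.seg_zero] at hd
  refine hd.hasDerivWithinAt.congr_of_eventuallyEq ?_ (by simp)
  filter_upwards [Icc_mem_nhdsGE (zero_lt_one : (0 : ℝ) < 1)] with t ht
  rw [hx.integral_eq t ht.1 (EReal.coe_lt_top t)]
  congr 1
  refine intervalIntegral.integral_congr fun s hs => ?_
  rw [uIcc_of_le ht.1] at hs
  simp only [hseg s ⟨hs.1, hs.2.trans ht.2⟩]

theorem eventually_exp_neg_mul_le (b : ℝ) (hb : 0 ≤ b) {ε : ℝ} (hε : 0 < ε) :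
    ∀ᶠ h in 𝓝[>] (0 : ℝ), Real.exp (-h) * b ≤ b + (-b + ε) * h := by
  filter_upwards [Ioo_mem_nhdsGT (lt_min one_pos (div_pos hε (by positivity : 0 < b + 1)))]
    with h hh
  have h1 : h ≤ 1 := hh.2.le.trans (min_le_left _ _)
  have h2 : h ≤ ε / (b + 1) := hh.2.le.trans (min_le_right _ _)
  rw [le_div_iff₀ (by positivity)] at h2
  have h3 := (abs_le.1 (Real.abs_exp_sub_one_sub_id_le (x := -h)
    (by rwa [abs_neg, abs_of_pos hh.1]))).2
  have h4 : Real.exp (-h) * b ≤ (1 - h + h ^ 2) * b :=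
    mul_le_mul_of_nonneg_right (by linarith [neg_sq h]) hb
  have h5 : h * (h * b) ≤ h * ε := mul_le_mul_of_nonneg_left (by linarith [hh.1]) hh.1.le
  linarith

namespace IsISSMargin

theorem driverD_le_neg (h : IsISSMargin f β μ σ ρ) (hV0 : ∀ φ, 0 ≤ V φ) (hV : LipOnBoundedV V)
    (hdec : ∀ φ d t, 0 ≤ t → V (h.flow t φ d) ≤ Real.exp (-t) * V φ) {v : Vec m}
    (hv : ‖v‖ ≤ ρ ‖φ‖) : driverD V φ (f φ v) ≤ ((-V φ : ℝ) : EReal) := by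
  obtain ⟨w, hw, rfl⟩ : ∃ w : Vec m, ‖w‖ ≤ 1 ∧ v = ρ ‖φ‖ • w := by
    rcases (h.nonneg ‖φ‖).eq_or_lt with h0 | h0
    · rw [← h0] at hv
      exact ⟨0, by simp, by rw [norm_le_zero_iff.1 hv, smul_zero]⟩
    · refine ⟨(ρ ‖φ‖)⁻¹ • v, ?_, by rw [smul_inv_smul₀ h0.ne']⟩
      rw [norm_smul, norm_inv, Real.norm_of_nonneg h0.le, inv_mul_le_iff₀ h0, mul_one]
      exact hv
  have hd : IsDisturbance fun _ : ℝ => w := ⟨measurable_const, fun _ => hw⟩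
  obtain ⟨x, hx⟩ := h.exists_solution hd φ
  have hder := hx.hasDerivWithinAt_zero_of_const (h.lip_rhs.closedLoop h.lip)
  have hcont : ContinuousOn x (Icc (0 - Δ) (0 + 1)) := by
    simpa using hx.continuousOn_Icc (EReal.coe_lt_top 1)
  have := driverD_le_of_seg (c := -V φ) hV one_pos hcont hder fun ε hε => by
    filter_upwards [eventually_exp_neg_mul_le (V φ) (hV0 φ) hε, self_mem_nhdsWithin] with s hs hs0
    rw [zero_add, hx.seg_zero, ← h.flow_eq hd hx (le_of_lt hs0)]
    exact (hdec φ _ s (le_of_lt hs0)).trans hs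
  rwa [hx.seg_zero] at this

theorem exists_gain (h : IsISSMargin f β μ σ ρ) (hV0 : ∀ φ, 0 ≤ V φ) (hV : LipOnBoundedV V)
    (hdec : ∀ φ d t, 0 ≤ t → V (h.flow t φ d) ≤ Real.exp (-t) * V φ) :
    ∃ γ, ClassN γ ∧ ∀ (φ : Hist Δ n) (v : Vec m),
      driverD V φ (f φ v) ≤ ((-V φ + γ ‖v‖ : ℝ) : EReal) := by
  obtain ⟨g, hg, hg0, hgb⟩ := exists_monotone_bound
    (P := fun r K => ∀ (φ : Hist Δ n) (v : Vec m), ‖v‖ ≤ r → ρ ‖φ‖ < ‖v‖ →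
      driverD V φ (f φ v) ≤ ((-V φ + K * ‖v‖ : ℝ) : EReal))
    (fun r hr => by
      obtain ⟨R, hR⟩ := eventually_atTop.1 (tendsto_atTop.1 h.unbounded r)
      set B := max r |R| + 1 with hB
      have hrB : r ≤ B := by linarith [le_max_left r |R|]
      have hB0 : 0 < B := hr.trans_le hrB
      obtain ⟨L, hL, hL'⟩ := hV B hB0
      obtain ⟨K, hK, hK'⟩ := h.lip_rhs B hB0
      refine ⟨L * K, by positivity, fun φ v hv hφv => ?_⟩
      have hφ : ‖φ‖ ≤ |R| := by
        by_contra! hlt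
        exact absurd (hR ‖φ‖ ((le_abs_self R).trans hlt.le)) (hφv.trans_le hv).not_ge
      have hφB : ‖φ‖ + 1 ≤ B := by linarith [le_max_right r |R|]
      have h1 : driverD V φ (f φ 0) ≤ ((-V φ : ℝ) : EReal) :=
        h.driverD_le_neg hV0 hV hdec (by rw [norm_zero]; exact h.nonneg _)
      refine (driverD_le_add (w' := f φ v) h1 (fun φ₁ φ₂ h₁ h₂ =>
        hL' φ₁ φ₂ (h₁.trans hφB) (h₂.trans hφB)) hL.le).trans (EReal.coe_le_coe_iff.2 ?_)
      have h2 := hK' φ φ v 0 (by linarith) (by linarith) (hv.trans hrB)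
        (by rw [norm_zero]; exact hB0.le)
      rw [sub_self, norm_zero, zero_add, sub_zero] at h2
      have h3 := mul_le_mul_of_nonneg_left h2 hL.le
      linarith)
    (fun r L L' hP hL φ v hv hφv => (hP φ v hv hφv).trans
      (EReal.coe_le_coe_iff.2 (by gcongr)))
    (fun r r' L hP hr φ v hv hφv => hP φ v (hv.trans hr) hφv)
  obtain ⟨κ, hκ, hκle⟩ := exists_classKinf_mul_le hg fun s => (hg0 s).le
  refine ⟨κ, hκ.1.classN, fun φ v => ?_⟩
  rcases le_or_gt ‖v‖ (ρ ‖φ‖) with hv | hv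
  · refine (h.driverD_le_neg hV0 hV hdec hv).trans (EReal.coe_le_coe_iff.2 ?_)
    linarith [hκ.1.nonneg (norm_nonneg v)]
  · refine (hgb ‖v‖ φ v le_rfl hv).trans (EReal.coe_le_coe_iff.2 ?_)
    linarith [hκle ‖v‖ (norm_nonneg v)]

end IsISSMargin

theorem ISS.exists_isCoerciveLKF (hf : LipOnBounded f) (h : ISS Δ f) :
    ∃ V : Hist Δ n → ℝ, IsCoerciveLKF V ∧ ∃ α γ : ℝ → ℝ, ClassKinf α ∧ ClassN γ ∧
      ∀ (φ : Hist Δ n) (v : Vec m),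
        driverD V φ (f φ v) ≤ ((-α ‖φ‖ + γ ‖v‖ : ℝ) : EReal) := by
  obtain ⟨β, μ, σ, ρ, hM⟩ := h.exists_isISSMargin hf
  have : Nonempty {d : ℝ → Vec m // IsDisturbance d} :=
    ⟨⟨fun _ => 0, measurable_const, fun _ => by simp⟩⟩
  obtain ⟨V, hV0, hV, ⟨α₁, α₂, hα₁, hα₂, hα⟩, hdec⟩ := hM.isUniformlyAttractedFlow.exists_lyapunov
  obtain ⟨γ, hγ, hVγ⟩ := hM.exists_gain hV0 hV hdec
  refine ⟨V, ⟨hV0, hV, α₁, α₂, hα₁, hα₂, hα⟩, α₁, γ, hα₁, hγ, fun φ v =>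
    (hVγ φ v).trans (EReal.coe_le_coe_iff.2 ?_)⟩
  linarith [(hα φ).1]

end ConverseISS

theorem IsLKF.iss {Δ : ℝ≥0} {n m : ℕ} {f : Hist Δ n → Vec m → Vec n} {V : Hist Δ n → ℝ}
    {α χ : ℝ → ℝ} (hf : LipOnBounded f) (hV : IsLKF V) (hα : ClassP α) (hχ : ClassN χ)
    (h : ∀ (φ : Hist Δ n) (v : Vec m), χ ‖v‖ ≤ V φ →
      driverD V φ (f φ v) ≤ ((-α ‖ev0 φ‖ : ℝ) : EReal)) : ISS Δ f := by
  obtain ⟨hV0, hVlip, α₁, α₂, hα₁, hα₂, hb⟩ := hV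
  have hpw : IsPointwiseISSLKF f V α₁ α₂ α fun s => χ s + s :=
    { lip_rhs := hf
      nonneg := hV0
      lip := hVlip
      lower_classKinf := hα₁
      upper_classKinf := hα₂
      lower := fun φ => (hb φ).1
      upper := fun φ => (hb φ).2
      rate := hα
      gain := hχ.add_id.1.classN
      le_gain := fun s hs => by linarith [hχ.nonneg hs]
      driverD_le := fun φ v hv => h φ v (by linarith [norm_nonneg v]) }
  exact hpw.iss

/-- LKF characterizations of ISS. -/
theorem iss_LKF_characterization
    (Δ : ℝ≥0) (n m : ℕ) (f : Hist Δ n → Vec m → Vec n)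
    (hf : LipOnBounded f) (hf0 : f 0 0 = 0) :
    List.TFAE
      [ISS Δ f,
       ∃ V : Hist Δ n → ℝ, IsCoerciveLKF V ∧ ∃ α γ : ℝ → ℝ, ClassKinf α ∧ ClassN γ ∧
         ∀ (φ : Hist Δ n) (v : Vec m),
           driverD V φ (f φ v) ≤ ((-α ‖φ‖ + γ ‖v‖ : ℝ) : EReal),
       ∃ V : Hist Δ n → ℝ, IsLKF V ∧ ∃ α γ : ℝ → ℝ, ClassKinf α ∧ ClassN γ ∧
         ∀ (φ : Hist Δ n) (v : Vec m),
           driverD V φ (f φ v) ≤ ((-α (V φ) + γ ‖v‖ : ℝ) : EReal),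
       ∃ V : Hist Δ n → ℝ, IsLKF V ∧ ∃ α χ : ℝ → ℝ, ClassP α ∧ ClassN χ ∧
         ∀ (φ : Hist Δ n) (v : Vec m), χ ‖v‖ ≤ V φ →
           driverD V φ (f φ v) ≤ ((-α ‖ev0 φ‖ : ℝ) : EReal)] := by
  tfae_have 1 → 2 := fun h => h.exists_isCoerciveLKF hf
  tfae_have 2 → 3 := fun ⟨V, hV, α, γ, hα, hγ, h⟩ =>
    have ⟨α', hα', h'⟩ := hV.exists_driverD_le_of_norm hα h
    ⟨V, hV.isLKF, α', γ, hα', hγ, h'⟩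
  tfae_have 3 → 4 := fun ⟨V, hV, _, _, hα, hγ, h⟩ =>
    ⟨V, hV, hV.exists_driverD_le_of_gain hα hγ h⟩
  tfae_have 4 → 1 := fun ⟨_, hV, _, _, hα, hχ, h⟩ => hV.iss hf hα hχ h
  tfae_finish
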